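/- **Notation.** $\mathbb T^n=\mathbb R^n/\mathbb Z^n$; $B_r\subset\mathbb R^n$ is the open ball of radius $r$ centred at $0$. For $f$ on $\mathbb T^n\times B_1\times\mathbb R$ write $f^t(q,p)=f^t_p(q)=f(q,p,t)$. For $\sigma=k+\mu$ with $k\in\mathbb N$, $0\le\mu<1$, $|\cdot|_{C^\sigma}$ is the supremum of all partial derivatives of order at most $k$ plus, if $\mu>0$, the $\mu$-Hölder seminorm of the partial derivatives of order $k$; $C^\sigma$ is the class of $C^k$ functions for which this is finite. For vector- or matrix-valued functions, membership and norms are taken over all components. $\mathcal B_\sigma$ is the space of functions $f$ on $\mathbb T^n\times B_1\times\mathbb R$ that are continuous, whose partial derivatives $\partial_pf$ exist and are continuous on $\mathbb T^n\times B_1\times\mathbb R$, and with $f^t_p\in C^\sigma(\mathbb T^n)$ for all $(p,t)$. $\bar{\mathcal B}_{\sigma,k}$ is the space of $f$ with $\partial_q^if\in\mathcal B_{\sigma+k-i}$ for all $0\le i\le k$. For $l\ge1$, $$|f|_{\sigma,l}=\sup_{(p,t)}|f^t_p|_{C^\sigma}(1+|t|^l)+\sup_{(p,t)}|(\partial_pf)^t_p|_{C^0}(1+|t|^{l-1}),\qquad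 |f|_{\sigma,0}=\sup_{(p,t)}|f^t_p|_{C^\sigma}+\sup_{(p,t)}|(\partial_pf)^t_p|_{C^0},$$ and $\|f\|_{\sigma,k,l}=\max_{0\le i\le k}|\partial_q^if|_{\sigma+k-i,l}$. For a Hamiltonian $H$, $X_H=(\partial_pH,-\partial_qH)$, and $\varphi_{0,p}(q)=(q,p)$ is the trivial embedding of $\mathbb T^n$ at height $p$. Let $X,X_{0,\pm}$ be time-dependent vector fields on $\mathbb T^n\times B_1$ of class $C^\sigma$ for each fixed $t$, and $\varphi_{0,\pm}:\mathbb T^n\to\mathbb T^n\times B_1$ embeddings of class $C^\sigma$, such that for some $\omega_\pm\in\mathbb R^n$ $$\lim_{t\to\pm\infty}|X^t-X^t_{0,\pm}|_{C^\sigma}=0,\qquad X_{0,\pm}(\varphi_{0,\pm}(q),t)=\partial_q\varphi_{0,\pm}(q)\,\omega_\pm\quad\text{for all }(q,t)\in\mathbb T^n\times\mathbb R.$$ A curve $g:\mathbb R\to\mathbb T^n\times B_1$ with $g'(t)=X(g(t),t)$ for all $t$ is a *biasymptotically quasiperiodic solution associated to $(X,X_{0,\pm},\varphi_{0,\pm})$*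 if these conditions hold and there are $q_-,q_+\in\mathbb T^n$ with $\lim_{t\to\pm\infty}|g(t)-\varphi_{0,\pm}(q_\pm+\omega_\pm t)|=0$. **Theorem.** Let $\sigma\ge1$, $\Upsilon\ge1$, $l>1$, $0<\varepsilon<1$, and let $H(q,p,t)=h(p)+f(q,p,t)$ be a Hamiltonian on $\mathbb T^n\times B_1\times\mathbb R$ such that * $h\in C^2(B_1)$ with $|\partial_ph|_{C^1}<\infty$, and $f,\partial_pf\in\bar{\mathcal B}_{\sigma,2}$; * $|f|_{\sigma+2,0}+\|\partial_qf\|_{\sigma,1,l+2}+\|\partial_pf\|_{\sigma,2,l+1}<\varepsilon$; * $\partial_p^2H^t\in C^{\sigma+2}(\mathbb T^n\times B_1)$ for each fixed $t\in\mathbb R$, all partial derivatives of order $0\le i\le3$ of $\partial_p^2H$ in the variables $(q,p)$ are continuous on $\mathbb T^n\times B_1\times\mathbb R$, and $\sup_{t\in\mathbb R}|\partial_p^2H^t|_{C^{\sigma+2}}\le\Upsilon$. Then there exists a time-dependent Hamiltonian $\tilde h$ on $\mathbb T^n\times B_1\times\mathbb R$ (continuous, of class $C^1$ in $(q,p)$,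 with $X_{\tilde h}$ continuous) such that, if $\varepsilon$ is small enough with respect to $n$, $l$, $\Upsilon$ and $|\partial_ph|_{C^1}$ only, then for every $(q,p)\in\mathbb T^n\times B_{1/2}$ there exist $p_-,p_+\in B_1$ and a biasymptotically quasiperiodic solution $g$ associated to $(X_H,X_{0,\pm}=X_{\tilde h},\varphi_{0,\pm}=\varphi_{0,p_\pm})$ with $g(0)=(q,p)$. -/

import Mathlib

open scoped ENNReal Topology
open Filter Metric Set

noncomputable section

namespace Biasymptotic

/-- Euclidean space `ℝⁿ`. A function on the torus `𝕋ⁿ = ℝⁿ/ℤⁿ` is written as a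
`ℤⁿ`-periodic function on `ℝⁿ`, a point of `𝕋ⁿ` as one of its representatives. -/
abbrev E (n : ℕ) := EuclideanSpace ℝ (Fin n)

/-- The `i`-th coordinate vector of `ℝⁿ`. -/
def e {n : ℕ} (i : Fin n) : E n := EuclideanSpace.single i 1

/-- The coordinate vectors of `ℝⁿ × ℝⁿ`. -/
def e2 {n : ℕ} : Fin n ⊕ Fin n → E n × E n
  | Sum.inl i => (e i, 0)
  | Sum.inr i => (0, e i)

/-- The lattice point of `ℤⁿ ⊂ ℝⁿ` with coordinates `k`. -/
def latt {n : ℕ} (k : Fin n → ℤ) : E n := WithLp.toLp 2 fun i => (k i : ℝ)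

/-- The distance in `𝕋ⁿ` between the classes of `x` and `y`. -/
def distT {n : ℕ} (x y : E n) : ℝ := ⨅ k : Fin n → ℤ, ‖x - y - latt k‖

/-- Lift to `ℝⁿ × ℝⁿ` of the phase space `𝕋ⁿ × A`. -/
def phase {n : ℕ} (A : Set (E n)) : Set (E n × E n) := univ ×ˢ A

/-- Lift to `ℝⁿ × ℝⁿ × ℝ` of the extended phase space `𝕋ⁿ × A × ℝ`. -/
def extPhase {n : ℕ} (A : Set (E n)) : Set (E n × E n × ℝ) := univ ×ˢ (A ×ˢ univ)

/-! ### Hölder classes -/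

/-- The partial derivative of `f` on `s`, of order `j`, in the directions
`b (v 0), …, b (v (j-1))`. -/
def partialOn {V F ι : Type*} [NormedAddCommGroup V] [NormedSpace ℝ V]
    [NormedAddCommGroup F] [NormedSpace ℝ F] (b : ι → V) (s : Set V) (f : V → F)
    (j : ℕ) (v : Fin j → ι) (x : V) : F :=
  iteratedFDerivWithin ℝ j f s x fun a => b (v a)

/-- The `C^k` norm on `s`: supremum of all partial derivatives of order at most `k`
with respect to the coordinate vectors `b`. -/
def cNormOn {V F ι : Type*} [NormedAddCommGroup V] [NormedSpace ℝ V]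
    [NormedAddCommGroup F] [NormedSpace ℝ F] (b : ι → V) (k : ℕ) (s : Set V) (f : V → F) :
    ℝ≥0∞ :=
  ⨆ j : ℕ, ⨆ _ : j ≤ k, ⨆ v : Fin j → ι, ⨆ x ∈ s, ‖partialOn b s f j v x‖ₑ

/-- The `μ`-Hölder seminorm on `s` of the partial derivatives of order `k`. -/
def holderSeminormOn {V F ι : Type*} [NormedAddCommGroup V] [NormedSpace ℝ V]
    [NormedAddCommGroup F] [NormedSpace ℝ F] (b : ι → V) (k : ℕ) (μ : ℝ) (s : Set V)
    (f : V → F) : ℝ≥0∞ :=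
  ⨆ v : Fin k → ι, ⨆ x ∈ s, ⨆ y ∈ s, ⨆ _ : x ≠ y,
    ENNReal.ofReal (‖partialOn b s f k v x - partialOn b s f k v y‖ / ‖x - y‖ ^ μ)

/-- The Hölder norm `|f|_{C^σ}` on `s`; for an integer `σ` it is the `C^σ` norm. -/
def holderNormOn {V F ι : Type*} [NormedAddCommGroup V] [NormedSpace ℝ V]
    [NormedAddCommGroup F] [NormedSpace ℝ F] (b : ι → V) (σ : ℝ) (s : Set V) (f : V → F) :
    ℝ≥0∞ :=
  cNormOn b ⌊σ⌋₊ s f +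
    if (⌊σ⌋₊ : ℝ) = σ then 0 else holderSeminormOn b ⌊σ⌋₊ (σ - ⌊σ⌋₊) s f

/-- Membership in the Hölder class `C^σ(s)`. -/
def HolderOn {V F ι : Type*} [NormedAddCommGroup V] [NormedSpace ℝ V]
    [NormedAddCommGroup F] [NormedSpace ℝ F] (b : ι → V) (σ : ℝ) (s : Set V) (f : V → F) :
    Prop :=
  ContDiffOn ℝ ⌊σ⌋₊ f s ∧ holderNormOn b σ s f < ⊤

/-! ### Functions on `𝕋ⁿ × A × ℝ` -/

/-- `∂f/∂q_i`. -/
def dq {n : ℕ} (i : Fin n) (f : E n → E n → ℝ → ℝ) : E n → E n → ℝ → ℝ :=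
  fun q p t => fderiv ℝ (fun q' => f q' p t) q (e i)

/-- `∂f/∂p_i`. -/
def dp {n : ℕ} (i : Fin n) (f : E n → E n → ℝ → ℝ) : E n → E n → ℝ → ℝ :=
  fun q p t => fderiv ℝ (fun p' => f q p' t) p (e i)

/-- The iterated derivative `∂_{q_{v 0}} ⋯ ∂_{q_{v (j-1)}} f`. -/
def dqs {n : ℕ} (v : List (Fin n)) (f : E n → E n → ℝ → ℝ) : E n → E n → ℝ → ℝ :=
  v.foldr dq f

/-- `ℤⁿ`-periodicity in the angles. -/
def Per {n : ℕ} {F : Type*} (A : Set (E n)) (f : E n → E n → ℝ → F) : Prop :=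
  ∀ (q : E n), ∀ p ∈ A, ∀ (t : ℝ) (k : Fin n → ℤ), f (q + latt k) p t = f q p t

/-- The space `B_σ` of functions on `𝕋ⁿ × A × ℝ`: `f` is continuous, `∂_p f` exists and is
continuous, and every `f_p^t` is of class `C^σ(𝕋ⁿ)`. -/
structure MemB {n : ℕ} (σ : ℝ) (A : Set (E n)) (f : E n → E n → ℝ → ℝ) : Prop where
  per : Per A f
  cont : ContinuousOn (fun x : E n × E n × ℝ => f x.1 x.2.1 x.2.2) (extPhase A)
  diff : ∀ (q : E n), ∀ p ∈ A, ∀ t : ℝ, DifferentiableAt ℝ (fun p' => f q p' t) p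
  cont_dp : ∀ i : Fin n,
    ContinuousOn (fun x : E n × E n × ℝ => dp i f x.1 x.2.1 x.2.2) (extPhase A)
  holder : ∀ p ∈ A, ∀ t : ℝ, HolderOn e σ univ fun q => f q p t

/-- The space `B̄_{σ,k}`: all `∂_q^i f`, `0 ≤ i ≤ k`, belong to `B_{σ+k-i}`. -/
def MemBbar {n : ℕ} (σ : ℝ) (k : ℕ) (A : Set (E n)) (f : E n → E n → ℝ → ℝ) : Prop :=
  ∀ v : List (Fin n), v.length ≤ k → MemB (σ + k - v.length) A (dqs v f)

/-- The weight `1 + |t|^l`, and `1` for `l = 0`. -/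
def w1 (l t : ℝ) : ℝ := if l = 0 then 1 else 1 + |t| ^ l

/-- The weight `1 + |t|^(l-1)`, and `1` for `l = 0`. -/
def w2 (l t : ℝ) : ℝ := if l = 0 then 1 else 1 + |t| ^ (l - 1)

/-- The weighted norm `|f|_{σ,l}`, for `l = 0` or `l ≥ 1`. -/
def wnormB {n : ℕ} (σ l : ℝ) (A : Set (E n)) (f : E n → E n → ℝ → ℝ) : ℝ≥0∞ :=
  (⨆ p ∈ A, ⨆ t : ℝ, holderNormOn e σ univ (fun q => f q p t) * ENNReal.ofReal (w1 l t)) +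
    ⨆ p ∈ A, ⨆ t : ℝ, ⨆ q : E n, ⨆ i : Fin n, ‖dp i f q p t‖ₑ * ENNReal.ofReal (w2 l t)

/-- The weighted norm `‖f‖_{σ,k,l}`. -/
def wnormBbar {n : ℕ} (σ : ℝ) (k : ℕ) (l : ℝ) (A : Set (E n)) (f : E n → E n → ℝ → ℝ) :
    ℝ≥0∞ :=
  ⨆ v : List (Fin n), ⨆ _ : v.length ≤ k, wnormB (σ + k - v.length) l A (dqs v f)

/-! ### Hamiltonian vector fields and biasymptotically quasiperiodic solutions -/

/-- The Hamiltonian vector field `X_H = (∂_p H, -∂_q H)`. -/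
def XH {n : ℕ} (H : E n → E n → ℝ → ℝ) (q p : E n) (t : ℝ) : E n × E n :=
  (WithLp.toLp 2 fun i => dp i H q p t, WithLp.toLp 2 fun i => -dq i H q p t)

/-- A time-dependent Hamiltonian on `𝕋ⁿ × A × ℝ`: periodic in the angles, continuous, of
class `C¹` in `(q, p)`, with a continuous Hamiltonian vector field. -/
structure IsHamiltonian {n : ℕ} (A : Set (E n)) (H : E n → E n → ℝ → ℝ) : Prop where
  per : Per A H
  cont : ContinuousOn (fun x : E n × E n × ℝ => H x.1 x.2.1 x.2.2) (extPhase A)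
  smooth : ∀ t : ℝ, ContDiffOn ℝ 1 (fun x : E n × E n => H x.1 x.2 t) (phase A)
  cont_X : ContinuousOn (fun x : E n × E n × ℝ => XH H x.1 x.2.1 x.2.2) (extPhase A)

/-- A time-dependent vector field on `𝕋ⁿ × A`, of class `C^σ` for every fixed time. -/
structure IsVectorField {n : ℕ} (σ : ℝ) (A : Set (E n)) (X : E n → E n → ℝ → E n × E n) :
    Prop where
  per : Per A X
  holder : ∀ t : ℝ, HolderOn e2 σ (phase A) fun x : E n × E n => X x.1 x.2 t

/-- A `C^σ` embedding `𝕋ⁿ → 𝕋ⁿ × A` for `σ ≥ 1` (an injective immersion of the compact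
torus), written through a lift `φ : ℝⁿ → ℝⁿ × ℝⁿ`. The lift is the sum of a linear map that
preserves `ℤⁿ` and a periodic map of class `C^σ`. -/
structure IsTorusEmbedding {n : ℕ} (σ : ℝ) (A : Set (E n)) (φ : E n → E n × E n) : Prop where
  mem : ∀ q, (φ q).2 ∈ A
  lift : ∃ L : E n →L[ℝ] E n, (∀ k : Fin n → ℤ, ∃ m : Fin n → ℤ, L (latt k) = latt m) ∧
    (∀ (q : E n) (k : Fin n → ℤ), φ (q + latt k) - (L (q + latt k), 0) = φ q - (L q, 0)) ∧
    HolderOn e σ univ fun q : E n => φ q - (L q, 0)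
  inj : ∀ (q q' : E n) (k : Fin n → ℤ), (φ q).1 - (φ q').1 = latt k → (φ q).2 = (φ q').2 →
    ∃ m : Fin n → ℤ, q - q' = latt m
  immersion : ∀ q, Function.Injective (fderiv ℝ φ q)

/-- The standing assumptions on `(X, X_{0,±}, φ_{0,±})` with frequency vectors `ω_±`: the
vector fields are of class `C^{σ+k}`, the embeddings of class `C^σ`, `X` converges to
`X_{0,±}` in `C^{σ+k}` as `t → ±∞`, and the torus `φ_{0,±}` is invariant for `X_{0,±}`
with the quasiperiodic dynamics of frequency `ω_±`. -/
structure AsymptoticData {n : ℕ} (σ : ℝ) (k : ℕ) (A : Set (E n))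
    (X Xp Xm : E n → E n → ℝ → E n × E n) (φp φm : E n → E n × E n) (ωp ωm : E n) :
    Prop where
  field : IsVectorField (σ + k) A X
  field_p : IsVectorField (σ + k) A Xp
  field_m : IsVectorField (σ + k) A Xm
  emb_p : IsTorusEmbedding σ A φp
  emb_m : IsTorusEmbedding σ A φm
  lim_p : Tendsto (fun t : ℝ => holderNormOn e2 (σ + k) (phase A)
    fun x : E n × E n => X x.1 x.2 t - Xp x.1 x.2 t) atTop (𝓝 0)
  lim_m : Tendsto (fun t : ℝ => holderNormOn e2 (σ + k) (phase A)
    fun x : E n × E n => X x.1 x.2 t - Xm x.1 x.2 t) atBot (𝓝 0)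
  inv_p : ∀ (q : E n) (t : ℝ), Xp (φp q).1 (φp q).2 t = fderiv ℝ φp q ωp
  inv_m : ∀ (q : E n) (t : ℝ), Xm (φm q).1 (φm q).2 t = fderiv ℝ φm q ωm

/-- `g` (a lift to `ℝⁿ × ℝⁿ` of a curve in `𝕋ⁿ × A`) is an integral curve of `X`. -/
def IsIntegral {n : ℕ} (A : Set (E n)) (X : E n → E n → ℝ → E n × E n) (g : ℝ → E n × E n) :
    Prop :=
  ∀ t : ℝ, (g t).2 ∈ A ∧ HasDerivAt g (X (g t).1 (g t).2 t) t

/-- The distance in `𝕋ⁿ × ℝⁿ`. -/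
def distPhase {n : ℕ} (x y : E n × E n) : ℝ := distT x.1 y.1 + ‖x.2 - y.2‖

/-- `g` is a biasymptotically quasiperiodic solution associated to
`(X, X_{0,±}, φ_{0,±})` with frequency vectors `ω_±`. -/
structure IsBiasymptotic {n : ℕ} (σ : ℝ) (k : ℕ) (A : Set (E n))
    (X Xp Xm : E n → E n → ℝ → E n × E n) (φp φm : E n → E n × E n) (ωp ωm : E n)
    (g : ℝ → E n × E n) : Prop where
  data : AsymptoticData σ k A X Xp Xm φp φm ωp ωm
  curve : IsIntegral A X g
  future : ∃ qp : E n, Tendsto (fun t : ℝ => distPhase (g t) (φp (qp + t • ωp))) atTop (𝓝 0)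
  past : ∃ qm : E n, Tendsto (fun t : ℝ => distPhase (g t) (φm (qm + t • ωm))) atBot (𝓝 0)

/-- The trivial embedding `φ_{0,p}(q) = (q, p)`. -/
def trivEmb {n : ℕ} (p : E n) : E n → E n × E n := fun q => (q, p)

/-- The Hamiltonian `H(q, p, t) = h(p) + f(q, p, t)`. -/
def ham {n : ℕ} (h : E n → ℝ) (f : E n → E n → ℝ → ℝ) : E n → E n → ℝ → ℝ :=
  fun q p t => h p + f q p t

/-- The assumptions on `H = h + f` with parameters `σ, Υ, l, ε`, on `𝕋ⁿ × B₁ × ℝ`. -/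
structure IsPerturbed {n : ℕ} (σ Υ l ε : ℝ) (h : E n → ℝ) (f : E n → E n → ℝ → ℝ) :
    Prop where
  /-- `∂_p h` is of class `C¹`. -/
  h_smooth : ContDiffOn ℝ 2 h (ball 0 1)
  f_mem : MemBbar σ 2 (ball 0 1) f
  dpf_mem : ∀ i, MemBbar σ 2 (ball 0 1) (dp i f)
  /-- `|f|_{σ+2,0} + ‖∂_q f‖_{σ,1,l+2} + ‖∂_p f‖_{σ,2,l+1} < ε`. -/
  small : wnormB (σ + 2) 0 (ball 0 1) f
      + (⨆ i, wnormBbar σ 1 (l + 2) (ball 0 1) (dq i f))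
      + (⨆ i, wnormBbar σ 2 (l + 1) (ball 0 1) (dp i f)) < ENNReal.ofReal ε
  /-- `∂_p² H^t ∈ C^{σ+2}(𝕋ⁿ × B₁)`. -/
  hess_mem : ∀ (t : ℝ) (i j : Fin n), HolderOn e2 (σ + 2) (phase (ball 0 1))
    fun x : E n × E n => dp i (dp j (ham h f)) x.1 x.2 t
  /-- `∂^m_{qp} (∂_p² H)` is continuous on `𝕋ⁿ × B₁ × ℝ` for `0 ≤ m ≤ 3`. -/
  hess_cont : ∀ (i j : Fin n) (m : ℕ), m ≤ 3 → ∀ v : Fin m → Fin n ⊕ Fin n,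
    ContinuousOn (fun x : E n × E n × ℝ => partialOn e2 (phase (ball 0 1))
      (fun y : E n × E n => dp i (dp j (ham h f)) y.1 y.2 x.2.2) m v (x.1, x.2.1))
      (extPhase (ball 0 1))
  /-- `sup_t |∂_p² H^t|_{C^{σ+2}} ≤ Υ`. -/
  hess_bound : (⨆ t : ℝ, ⨆ i : Fin n, ⨆ j : Fin n, holderNormOn e2 (σ + 2) (phase (ball 0 1))
    fun x : E n × E n => dp i (dp j (ham h f)) x.1 x.2 t) ≤ ENNReal.ofReal Υ

/-- The norm `|∂_p h|_{C¹}` on `B₁`. -/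
def freqNorm {n : ℕ} (h : E n → ℝ) : ℝ≥0∞ :=
  ⨆ i : Fin n, cNormOn e 1 (ball 0 1) fun p => fderiv ℝ h p (e i)

end Biasymptotic

end

open Biasymptotic

noncomputable section

namespace Biasymptotic

set_option maxSynthPendingDepth 3

section BoundedDerivatives

variable {V F G : Type*} [NormedAddCommGroup V] [NormedSpace ℝ V]
  [NormedAddCommGroup F] [NormedSpace ℝ F] [NormedAddCommGroup G] [NormedSpace ℝ G]

/-- `f` is of class `C^m` on `s` and its derivatives of order at most `m` are bounded by `M`
in operator norm. -/
def BddDeriv (m : ℕ) (M : ℝ) (s : Set V) (f : V → F) : Prop :=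
  ContDiffOn ℝ m f s ∧ ∀ j ≤ m, ∀ x ∈ s, ‖iteratedFDerivWithin ℝ j f s x‖ ≤ M

variable {m k : ℕ} {M N : ℝ} {s : Set V} {f g : V → F}

theorem BddDeriv.mono (hf : BddDeriv m M s f) (h : M ≤ N) : BddDeriv m N s f :=
  ⟨hf.1, fun j hj x hx => (hf.2 j hj x hx).trans h⟩

theorem BddDeriv.of_le (hf : BddDeriv m M s f) (h : k ≤ m) : BddDeriv k M s f :=
  ⟨hf.1.of_le (by exact_mod_cast h), fun j hj x hx => hf.2 j (hj.trans h) x hx⟩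

theorem BddDeriv.congr (hf : BddDeriv m M s f) (h : EqOn g f s) : BddDeriv m M s g :=
  ⟨hf.1.congr h, fun j hj x hx => by
    rw [iteratedFDerivWithin_congr h hx]; exact hf.2 j hj x hx⟩

theorem BddDeriv.norm_le (hf : BddDeriv m M s f) {x : V} (hx : x ∈ s) : ‖f x‖ ≤ M := by
  simpa using hf.2 0 (Nat.zero_le _) x hx

theorem BddDeriv.add (hs : UniqueDiffOn ℝ s) (hf : BddDeriv m M s f) (hg : BddDeriv m N s g) :
    BddDeriv m (M + N) s (fun x => f x + g x) := by
  refine ⟨hf.1.add hg.1, fun j hj x hx => ?_⟩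
  have hj' : (j : WithTop ℕ∞) ≤ m := by exact_mod_cast hj
  have := iteratedFDerivWithin_add_apply (i := j) ((hf.1 x hx).of_le hj')
    ((hg.1 x hx).of_le hj') hs hx
  change ‖iteratedFDerivWithin ℝ j (f + g) s x‖ ≤ _
  rw [this]
  exact (norm_add_le _ _).trans (add_le_add (hf.2 j hj x hx) (hg.2 j hj x hx))

theorem BddDeriv.clm_comp (hs : UniqueDiffOn ℝ s) (hf : BddDeriv m M s f) (L : F →L[ℝ] G) :
    BddDeriv m (‖L‖ * M) s (fun x => L (f x)) := by
  refine ⟨L.contDiff.comp_contDiffOn hf.1, fun j hj x hx => ?_⟩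
  have hj' : (j : WithTop ℕ∞) ≤ m := by exact_mod_cast hj
  refine (L.norm_iteratedFDerivWithin_comp_left (hf.1 x hx) hs hx hj').trans ?_
  gcongr
  exact hf.2 j hj x hx

theorem bddDeriv_const (hM : 0 ≤ M) (c : F) (hc : ‖c‖ ≤ M) :
    BddDeriv m M s (fun _ => c) := by
  refine ⟨contDiffOn_const, fun j _ x _ => ?_⟩
  rcases j with _ | j
  · simpa using hc
  · rw [iteratedFDerivWithin_succ_const]
    simpa using hM

theorem BddDeriv.sum {ι : Type*} (hs : UniqueDiffOn ℝ s) (I : Finset ι) {f : ι → V → F}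
    (hf : ∀ i ∈ I, BddDeriv m M s (f i)) : BddDeriv m (I.card * M) s (fun x => ∑ i ∈ I, f i x) := by
  classical
  induction I using Finset.induction_on with
  | empty => simpa using bddDeriv_const (le_refl (0 : ℝ)) (0 : F) (by simp)
  | insert a I ha ih =>
    simp only [Finset.sum_insert ha, Finset.card_insert_of_notMem ha]
    refine ((hf a (by simp)).add hs (ih fun i hi => hf i (by simp [hi]))).mono ?_
    push_cast
    linarith

theorem BddDeriv.fderiv (hs : IsOpen s) (hf : BddDeriv (m + 1) M s f) :
    BddDeriv m M s (_root_.fderiv ℝ f) := by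
  have h : BddDeriv m M s (fderivWithin ℝ f s) := by
    refine ⟨?_, fun j hj x hx => ?_⟩
    · have := hf.1
      push_cast at this
      exact ((contDiffOn_succ_iff_fderivWithin hs.uniqueDiffOn).1 this).2.2
    · rw [norm_iteratedFDerivWithin_fderivWithin hs.uniqueDiffOn hx]
      exact hf.2 (j + 1) (by lia) x hx
  exact h.congr fun x hx => (fderivWithin_of_isOpen hs hx).symm

theorem BddDeriv.hasFDerivAt (hs : IsOpen s) (hf : BddDeriv (m + 1) M s f) {x : V} (hx : x ∈ s) :
    HasFDerivAt f (_root_.fderiv ℝ f x) x :=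
  ((hf.1.differentiableOn (by simp) x hx).differentiableAt (hs.mem_nhds hx)).hasFDerivAt

theorem BddDeriv.of_hasFDerivAt (hs : IsOpen s) {f' : V → V →L[ℝ] F}
    (hd : ∀ x ∈ s, HasFDerivAt f (f' x) x) (hb : ∀ x ∈ s, ‖f x‖ ≤ M) (hf' : BddDeriv m M s f') :
    BddDeriv (m + 1) M s f := by
  have h : BddDeriv m M s (fderivWithin ℝ f s) := hf'.congr fun x hx => by
    rw [fderivWithin_of_isOpen hs hx, (hd x hx).fderiv]
  refine ⟨?_, fun j hj x hx => ?_⟩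
  · push_cast
    exact (contDiffOn_succ_iff_fderivWithin hs.uniqueDiffOn).2
      ⟨fun x hx => (hd x hx).differentiableAt.differentiableWithinAt, by simp, h.1⟩
  · rcases j with _ | j
    · simpa using hb x hx
    · rw [← norm_iteratedFDerivWithin_fderivWithin hs.uniqueDiffOn hx]
      exact h.2 j (by lia) x hx

/-- The Lipschitz estimate for the derivative of order `m` on an open convex set. -/
theorem BddDeriv.lipschitz (hs : IsOpen s) (hc : Convex ℝ s) (hf : BddDeriv (m + 1) M s f)
    {x y : V} (hx : x ∈ s) (hy : y ∈ s) :
    ‖iteratedFDerivWithin ℝ m f s x - iteratedFDerivWithin ℝ m f s y‖ ≤ M * ‖x - y‖ := by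
  have hd : ∀ z ∈ s, DifferentiableWithinAt ℝ (iteratedFDerivWithin ℝ m f s) s z := fun z hz =>
    hf.1.differentiableOn_iteratedFDerivWithin (by exact_mod_cast m.lt_succ_self)
      hs.uniqueDiffOn z hz
  refine hc.norm_image_sub_le_of_norm_fderivWithin_le hd (fun z hz => ?_) hy hx
  rw [norm_fderivWithin_iteratedFDerivWithin]
  exact hf.2 (m + 1) le_rfl z hz

theorem BddDeriv.norm_sub_le (hs : IsOpen s) (hc : Convex ℝ s) (hf : BddDeriv (m + 1) M s f)
    {x y : V} (hx : x ∈ s) (hy : y ∈ s) : ‖f x - f y‖ ≤ M * ‖x - y‖ :=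
  hc.norm_image_sub_le_of_norm_hasFDerivWithin_le
    (fun _ hz => (hf.hasFDerivAt hs hz).hasFDerivWithinAt)
    (fun _ hz => (hf.fderiv hs).norm_le hz) hy hx

end BoundedDerivatives

section MixedRegularity

variable {E₁ E₂ F : Type*} [NormedAddCommGroup E₁] [NormedSpace ℝ E₁]
  [NormedAddCommGroup E₂] [NormedSpace ℝ E₂] [NormedAddCommGroup F] [NormedSpace ℝ F]

/-- Symmetry of mixed partial derivatives: if `v = ∂_p u`, and `z = ∂_q v` is continuous, then
`w = ∂_q u` is differentiable in `p` and `∂_p w` is `z` with its arguments exchanged. -/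
theorem hasFDerivAt_partial_swap {A : Set E₂} (hA : IsOpen A) {u : E₁ → E₂ → F}
    {w : E₁ → E₂ → E₁ →L[ℝ] F} {v : E₁ → E₂ → E₂ →L[ℝ] F} {z : E₁ → E₂ → E₁ →L[ℝ] E₂ →L[ℝ] F}
    (hw : ∀ q, ∀ p ∈ A, HasFDerivAt (fun q' => u q' p) (w q p) q)
    (hv : ∀ q, ∀ p ∈ A, HasFDerivAt (u q) (v q p) p)
    (hz : ∀ q, ∀ p ∈ A, HasFDerivAt (fun q' => v q' p) (z q p) q)
    {q : E₁} {p : E₂} (hp : p ∈ A) (hc : ContinuousAt (fun x : E₁ × E₂ => z x.1 x.2) (q, p)) :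
    HasFDerivAt (w q) (z q p).flip p := by
  rw [hasFDerivAt_iff_isLittleO, Asymptotics.isLittleO_iff]
  intro η hη
  obtain ⟨δ₁, hδ₁, h₁⟩ := Metric.continuousAt_iff.1 hc (η / 2) (half_pos hη)
  obtain ⟨δ₂, hδ₂, h₂⟩ := Metric.isOpen_iff.1 hA p hp
  set δ := min δ₁ δ₂ with hδ
  have hδ0 : 0 < δ := lt_min hδ₁ hδ₂
  have hball : ball p δ ⊆ A := (ball_subset_ball (min_le_right _ _)).trans h₂
  have hzb : ∀ q' ∈ ball q δ, ∀ p' ∈ ball p δ, ‖z q' p' - z q p‖ ≤ η / 2 := by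
    intro q' hq' p' hp'
    rw [← dist_eq_norm]
    refine (h₁ (x := (q', p')) ?_).le
    rw [Prod.dist_eq]
    exact max_lt ((mem_ball.1 hq').trans_le (min_le_left _ _))
      ((mem_ball.1 hp').trans_le (min_le_left _ _))
  filter_upwards [ball_mem_nhds p hδ0] with p' hp'
  have hpp : p ∈ ball p δ := mem_ball_self hδ0
  have hqq : q ∈ ball q δ := mem_ball_self hδ0
  have hφ : HasFDerivAt (fun q' => u q' p' - u q' p - v q' p (p' - p))
      (w q p' - w q p - (z q p).flip (p' - p)) q := by
    refine ((hw q p' (hball hp')).sub (hw q p hp)).sub ?_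
    exact (hz q p hp).clm_apply (hasFDerivAt_const (p' - p) q) |>.congr_fderiv (by ext; simp)
  refine hφ.le_of_lip' (by positivity) ?_
  filter_upwards [ball_mem_nhds q hδ0] with q' hq'
  have key : ∀ p'' ∈ ball p δ,
      ‖(v q' p'' - v q p'') - (v q' p - v q p)‖ ≤ η * ‖q' - q‖ := by
    intro p'' hp''
    have := (convex_ball q δ).norm_image_sub_le_of_norm_hasFDerivWithin_le
      (f := fun r => v r p'' - v r p) (f' := fun r => z r p'' - z r p) (C := η)
      (fun r _ => ((hz r p'' (hball hp'')).sub (hz r p hp)).hasFDerivWithinAt)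
      (fun r hr => by
        have e : z r p'' - z r p = (z r p'' - z q p) - (z r p - z q p) := by abel
        rw [e]
        refine (norm_sub_le _ _).trans ?_
        linarith [hzb r hr p'' hp'', hzb r hr p hpp]) hqq hq'
    have e : (v q' p'' - v q p'') - (v q' p - v q p)
        = (v q' p'' - v q' p) - (v q p'' - v q p) := by abel
    rw [e]
    exact this
  have := (convex_ball p δ).norm_image_sub_le_of_norm_hasFDerivWithin_le'
    (f := fun r => u q' r - u q r) (f' := fun r => v q' r - v q r) (φ := v q' p - v q p)
    (fun r hr => ((hv q' r (hball hr)).sub (hv q r (hball hr))).hasFDerivWithinAt)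
    key hpp hp'
  have e : u q' p' - u q' p - v q' p (p' - p) - (u q p' - u q p - v q p (p' - p))
      = u q' p' - u q p' - (u q' p - u q p) - (v q' p - v q p) (p' - p) := by
    simp only [sub_apply]
    abel
  rw [e]
  refine this.trans (le_of_eq ?_)
  ring

end MixedRegularity

section MixedRegularityInduction

universe u

/-- A function `u(q, p)` that is `C^m` in `q`, and whose derivative `∂_p u` is jointly `C^m`, is
jointly `C^m`. -/
theorem bddDeriv_uncurry {E₁ E₂ : Type u} [NormedAddCommGroup E₁] [NormedSpace ℝ E₁]
    [NormedAddCommGroup E₂] [NormedSpace ℝ E₂] {A : Set E₂} (hA : IsOpen A) (hAc : Convex ℝ A)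
    {M : ℝ} (m : ℕ) {F : Type u} [NormedAddCommGroup F] [NormedSpace ℝ F]
    {u : E₁ → E₂ → F} {v : E₁ → E₂ → E₂ →L[ℝ] F}
    (hq : ∀ p ∈ A, BddDeriv m M univ (fun q => u q p))
    (hp : ∀ q, ∀ p ∈ A, HasFDerivAt (u q) (v q p) p)
    (hv : BddDeriv m M (univ ×ˢ A) (fun x : E₁ × E₂ => v x.1 x.2)) :
    BddDeriv m ((m + 1) * M) (univ ×ˢ A) (fun x : E₁ × E₂ => u x.1 x.2) := by
  have hU : IsOpen ((univ : Set E₁) ×ˢ A) := isOpen_univ.prod hA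
  induction m generalizing F with
  | zero =>
    have hb : ∀ x ∈ (univ : Set E₁) ×ˢ A, ‖u x.1 x.2‖ ≤ M := fun x hx =>
      (hq x.2 hx.2).norm_le (mem_univ x.1)
    refine ⟨?_, fun j hj x hx => ?_⟩
    · refine contDiffOn_zero.2 fun x hx => ContinuousAt.continuousWithinAt ?_
      have hM : 0 ≤ M := (norm_nonneg _).trans (hb x hx)
      have hcq : ContinuousAt (fun y : E₁ × E₂ => u y.1 x.2) x := by
        have := (contDiffOn_univ.1 (hq x.2 hx.2).1).continuous
        exact (this.comp continuous_fst).continuousAt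
      have hlip : Tendsto (fun y : E₁ × E₂ => u y.1 y.2 - u y.1 x.2) (𝓝 x) (𝓝 0) := by
        refine squeeze_zero_norm' (a := fun y : E₁ × E₂ => M * ‖y.2 - x.2‖) ?_ ?_
        · filter_upwards [hU.mem_nhds hx] with y hy
          exact hAc.norm_image_sub_le_of_norm_hasFDerivWithin_le
            (fun p hp' => (hp y.1 p hp').hasFDerivWithinAt)
            (fun p hp' => hv.norm_le (x := (y.1, p)) ⟨mem_univ _, hp'⟩) hx.2 hy.2
        · have : Continuous fun y : E₁ × E₂ => M * ‖y.2 - x.2‖ := by fun_prop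
          simpa using this.tendsto x
      have := hlip.add hcq
      simpa [ContinuousAt] using this
    · obtain rfl : j = 0 := by lia
      simpa using hb x hx
  | succ m ih =>
    by_cases hne : A.Nonempty
    swap
    · obtain rfl := not_nonempty_iff_eq_empty.1 hne
      simp [BddDeriv, contDiffOn_empty]
    obtain ⟨p₀, hp₀⟩ := hne
    have hM : 0 ≤ M := (norm_nonneg _).trans ((hq p₀ hp₀).norm_le (mem_univ 0))
    set V' : E₁ × E₂ → E₂ →L[ℝ] F := fun x => v x.1 x.2 with hV'
    set w : E₁ → E₂ → E₁ →L[ℝ] F := fun q p => fderiv ℝ (fun q' => u q' p) q with hwdef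
    set z : E₁ → E₂ → E₁ →L[ℝ] E₂ →L[ℝ] F :=
      fun q p => (fderiv ℝ V' (q, p)).comp (ContinuousLinearMap.inl ℝ E₁ E₂) with hzdef
    have hw : ∀ q, ∀ p ∈ A, HasFDerivAt (fun q' => u q' p) (w q p) q := fun q p hp' =>
      (hq p hp').hasFDerivAt isOpen_univ (mem_univ q)
    have hz : ∀ q, ∀ p ∈ A, HasFDerivAt (fun q' => v q' p) (z q p) q := fun q p hp' => by
      have h1 : HasFDerivAt V' (fderiv ℝ V' (q, p)) (q, p) :=
        hv.hasFDerivAt hU (x := (q, p)) ⟨mem_univ _, hp'⟩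
      exact HasFDerivAt.comp (f := fun q' => (q', p)) q h1 (hasFDerivAt_prodMk_left q p)
    have hzB : BddDeriv m M (univ ×ˢ A) (fun x : E₁ × E₂ => (z x.1 x.2).flip) := by
      let L₁ : ((E₁ × E₂) →L[ℝ] E₂ →L[ℝ] F) →L[ℝ] (E₁ →L[ℝ] E₂ →L[ℝ] F) :=
        (ContinuousLinearMap.compL ℝ E₁ (E₁ × E₂) (E₂ →L[ℝ] F)).flip
          (ContinuousLinearMap.inl ℝ E₁ E₂)
      have hL₁ : ‖L₁‖ ≤ 1 := by
        refine L₁.opNorm_le_bound zero_le_one fun T => ?_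
        rw [one_mul]
        refine (ContinuousLinearMap.opNorm_comp_le T (ContinuousLinearMap.inl ℝ E₁ E₂)).trans ?_
        exact mul_le_of_le_one_right (norm_nonneg _)
          (ContinuousLinearMap.norm_inl_le_one ℝ E₁ E₂)
      let L₂ : (E₁ →L[ℝ] E₂ →L[ℝ] F) →L[ℝ] (E₂ →L[ℝ] E₁ →L[ℝ] F) :=
        (ContinuousLinearMap.flipₗᵢ ℝ E₁ E₂ F).toContinuousLinearEquiv
      have hL₂ : ‖L₂‖ ≤ 1 := by
        refine L₂.opNorm_le_bound zero_le_one fun T => ?_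
        rw [one_mul]
        exact ((ContinuousLinearMap.flipₗᵢ ℝ E₁ E₂ F).norm_map T).le
      have h1 := ((hv.fderiv hU).clm_comp hU.uniqueDiffOn L₁).mono
        (mul_le_of_le_one_left hM hL₁)
      exact (h1.clm_comp hU.uniqueDiffOn L₂).mono (mul_le_of_le_one_left hM hL₂)
    have hzc : ∀ x ∈ (univ : Set E₁) ×ˢ A, ContinuousAt (fun x : E₁ × E₂ => z x.1 x.2) x := by
      intro x hx
      have h1 : ContinuousAt (fun x : E₁ × E₂ => (z x.1 x.2).flip) x :=
        hzB.1.continuousOn.continuousAt (hU.mem_nhds hx)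
      exact (ContinuousLinearMap.flipₗᵢ ℝ E₂ E₁ F).continuous.continuousAt.comp h1
    have hwB := ih (u := w) (v := fun q p => (z q p).flip)
      (fun p hp' => (hq p hp').fderiv isOpen_univ)
      (fun q p hp' => hasFDerivAt_partial_swap hA hw hp hz hp' (hzc (q, p) ⟨mem_univ _, hp'⟩)) hzB
    have hvB : BddDeriv m M (univ ×ˢ A) V' := hv.of_le m.le_succ
    let C₁ : (E₁ →L[ℝ] F) →L[ℝ] ((E₁ × E₂) →L[ℝ] F) :=
      (ContinuousLinearMap.compL ℝ (E₁ × E₂) E₁ F).flip (ContinuousLinearMap.fst ℝ E₁ E₂)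
    have hC₁ : ‖C₁‖ ≤ 1 := by
      refine C₁.opNorm_le_bound zero_le_one fun T => ?_
      rw [one_mul]
      refine (ContinuousLinearMap.opNorm_comp_le T (ContinuousLinearMap.fst ℝ E₁ E₂)).trans ?_
      exact mul_le_of_le_one_right (norm_nonneg _) (ContinuousLinearMap.norm_fst_le ℝ E₁ E₂)
    let C₂ : (E₂ →L[ℝ] F) →L[ℝ] ((E₁ × E₂) →L[ℝ] F) :=
      (ContinuousLinearMap.compL ℝ (E₁ × E₂) E₂ F).flip (ContinuousLinearMap.snd ℝ E₁ E₂)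
    have hC₂ : ‖C₂‖ ≤ 1 := by
      refine C₂.opNorm_le_bound zero_le_one fun T => ?_
      rw [one_mul]
      refine (ContinuousLinearMap.opNorm_comp_le T (ContinuousLinearMap.snd ℝ E₁ E₂)).trans ?_
      exact mul_le_of_le_one_right (norm_nonneg _) (ContinuousLinearMap.norm_snd_le ℝ E₁ E₂)
    have hD := ((hwB.clm_comp hU.uniqueDiffOn C₁).mono
      (mul_le_of_le_one_left (by positivity) hC₁)).add hU.uniqueDiffOn
      ((hvB.clm_comp hU.uniqueDiffOn C₂).mono (mul_le_of_le_one_left hM hC₂))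
    refine BddDeriv.of_hasFDerivAt hU (f' := fun x => C₁ (w x.1 x.2) + C₂ (v x.1 x.2))
      (fun x hx => ?_) (fun x hx => ?_) (hD.mono (le_of_eq ?_))
    · have := hasStrictFDerivAt_uncurry_coprod (𝕜 := ℝ) (u := x) (f := u) (f₁ := w) (f₂ := v)
        (by filter_upwards [hU.mem_nhds hx] with y hy using hw y.1 y.2 hy.2)
        (by filter_upwards [hU.mem_nhds hx] with y hy using hp y.1 y.2 hy.2)
        (hwB.1.continuousOn.continuousAt (hU.mem_nhds hx))
        (hvB.1.continuousOn.continuousAt (hU.mem_nhds hx))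
      refine this.hasFDerivAt.congr_fderiv ?_
      ext y <;> simp [C₁, C₂, Function.HasUncurry.uncurry]
    · refine ((hq x.2 hx.2).norm_le (mem_univ x.1)).trans ?_
      push_cast
      nlinarith
    · push_cast
      ring

end MixedRegularityInduction

section LipschitzDerivatives

variable {V F : Type*} [NormedAddCommGroup V] [NormedSpace ℝ V]
  [NormedAddCommGroup F] [NormedSpace ℝ F] {m : ℕ} {M : ℝ} {s : Set V} {f g : V → F}

theorem norm_iteratedFDerivWithin_zero_sub (f g : V → F) (s : Set V) (x y : V) :
    ‖iteratedFDerivWithin ℝ 0 f s x - iteratedFDerivWithin ℝ 0 g s y‖ = ‖f x - g y‖ := by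
  simp only [iteratedFDerivWithin_zero_eq_comp, Function.comp_apply, ← map_sub,
    LinearIsometryEquiv.norm_map]

theorem norm_iteratedFDerivWithin_succ_sub (hs : IsOpen s) {x y : V} (hx : x ∈ s) (hy : y ∈ s)
    (j : ℕ) :
    ‖iteratedFDerivWithin ℝ (j + 1) f s x - iteratedFDerivWithin ℝ (j + 1) g s y‖
      = ‖iteratedFDerivWithin ℝ j (fderiv ℝ f) s x
          - iteratedFDerivWithin ℝ j (fderiv ℝ g) s y‖ := by
  have hf : EqOn (fun z => fderivWithin ℝ f s z) (fderiv ℝ f) s := fun z hz =>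
    fderivWithin_of_isOpen hs hz
  have hg : EqOn (fun z => fderivWithin ℝ g s z) (fderiv ℝ g) s := fun z hz =>
    fderivWithin_of_isOpen hs hz
  rw [iteratedFDerivWithin_succ_eq_comp_right hs.uniqueDiffOn hx,
    iteratedFDerivWithin_succ_eq_comp_right hs.uniqueDiffOn hy, Function.comp_apply,
    Function.comp_apply, ← map_sub, LinearIsometryEquiv.norm_map,
    iteratedFDerivWithin_congr hf hx, iteratedFDerivWithin_congr hg hy]

/-- The derivatives of `f` of order at most `m` are bounded by `M` on `s`, and the derivative of
order `m` is `M`-Lipschitz. -/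
def LipDeriv (m : ℕ) (M : ℝ) (s : Set V) (f : V → F) : Prop :=
  BddDeriv m M s f ∧ ∀ x ∈ s, ∀ y ∈ s,
    ‖iteratedFDerivWithin ℝ m f s x - iteratedFDerivWithin ℝ m f s y‖ ≤ M * ‖x - y‖

theorem BddDeriv.lipDeriv (hs : IsOpen s) (hc : Convex ℝ s) (hf : BddDeriv (m + 1) M s f) :
    LipDeriv m M s f :=
  ⟨hf.of_le m.le_succ, fun _ hx _ hy => hf.lipschitz hs hc hx hy⟩

theorem LipDeriv.fderiv (hs : IsOpen s) (hf : LipDeriv (m + 1) M s f) :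
    LipDeriv m M s (_root_.fderiv ℝ f) :=
  ⟨hf.1.fderiv hs, fun x hx y hy => by
    rw [← norm_iteratedFDerivWithin_succ_sub hs hx hy]; exact hf.2 x hx y hy⟩

theorem LipDeriv.norm_sub_le (hs : IsOpen s) (hc : Convex ℝ s) (hf : LipDeriv m M s f)
    {x y : V} (hx : x ∈ s) (hy : y ∈ s) : ‖f x - f y‖ ≤ M * ‖x - y‖ := by
  rcases m with _ | m
  · rw [← norm_iteratedFDerivWithin_zero_sub f f s]
    exact hf.2 x hx y hy
  · exact hf.1.norm_sub_le hs hc hx hy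

end LipschitzDerivatives

section Interpolation

variable {n : ℕ}

theorem isOpen_phase : IsOpen (phase (ball (0 : E n) 1)) := isOpen_univ.prod isOpen_ball

theorem convex_phase : Convex ℝ (phase (ball (0 : E n) 1)) := convex_univ.prod (convex_ball 0 1)

/-- An interpolation inequality of Landau–Kolmogorov type on `𝕋ⁿ × B₁`. -/
theorem norm_deriv_le_of_lipschitz {F : Type*} [NormedAddCommGroup F] [NormedSpace ℝ F]
    {v : E n × E n → F} {v' : E n × E n → E n × E n →L[ℝ] F} {δ M r : ℝ}
    (hM : 0 ≤ M) (hr : 0 < r) (hr1 : r ≤ 1)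
    (hd : ∀ x ∈ phase (ball 0 1), HasFDerivAt v (v' x) x)
    (hl : ∀ x ∈ phase (ball 0 1), ∀ y ∈ phase (ball 0 1), ‖v' x - v' y‖ ≤ M * ‖x - y‖)
    (hb : ∀ x ∈ phase (ball 0 1), ‖v x‖ ≤ δ) {x : E n × E n} (hx : x ∈ phase (ball 0 1)) :
    ‖v' x‖ ≤ 4 * (2 * δ / r + 4 * M * r) := by
  have key : ∀ y ∈ phase (ball (0 : E n) 1), ‖y - x‖ ≤ 2 →
      ‖v' x (y - x)‖ ≤ 2 * δ / r + 4 * M * r := by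
    intro y hy hyx
    set z := x + r • (y - x) with hz
    have hzU : z ∈ phase (ball (0 : E n) 1) :=
      convex_phase.add_smul_sub_mem hx hy ⟨hr.le, hr1⟩
    have hseg : segment ℝ x z ⊆ phase (ball (0 : E n) 1) := convex_phase.segment_subset hx hzU
    have hzx : ‖z - x‖ ≤ 2 * r := by
      rw [hz, add_sub_cancel_left, norm_smul, Real.norm_of_nonneg hr.le]
      nlinarith
    have h1 := (convex_segment x z).norm_image_sub_le_of_norm_hasFDerivWithin_le'
      (f := v) (f' := v') (φ := v' x) (C := M * (2 * r))
      (fun a ha => (hd a (hseg ha)).hasFDerivWithinAt)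
      (fun a ha => (hl a (hseg ha) x hx).trans (by
        gcongr
        refine le_trans ?_ hzx
        rw [norm_sub_rev a x, norm_sub_rev z x]
        have := dist_add_dist_of_mem_segment ha
        rw [dist_eq_norm, dist_eq_norm, dist_eq_norm] at this
        linarith [norm_nonneg (a - z)]))
      (left_mem_segment ℝ x z) (right_mem_segment ℝ x z)
    have h2 : ‖v' x (z - x)‖ ≤ 2 * δ + M * (2 * r) * (2 * r) := by
      have e : v' x (z - x) = (v z - v x) - (v z - v x - v' x (z - x)) := by abel
      rw [e]
      have h3 : M * (2 * r) * ‖z - x‖ ≤ M * (2 * r) * (2 * r) := by gcongr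
      linarith [norm_sub_le (v z - v x) (v z - v x - v' x (z - x)), norm_sub_le (v z) (v x),
        hb z hzU, hb x hx]
    rw [hz, add_sub_cancel_left, map_smul, norm_smul, Real.norm_of_nonneg hr.le] at h2
    have e : 2 * δ / r + 4 * M * r = (2 * δ + M * (2 * r) * (2 * r)) / r := by
      field_simp
      ring
    rw [e, le_div_iff₀ hr, mul_comm]
    exact h2
  have hx2 : ‖x.2‖ < 1 := by simpa [phase] using hx
  have hnn : 0 ≤ 2 * δ / r + 4 * M * r := (norm_nonneg _).trans (key x hx (by simp))
  refine ContinuousLinearMap.opNorm_le_of_unit_norm (by positivity) fun w hw => ?_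
  have hw1 : ‖w.1‖ ≤ 1 := hw ▸ norm_fst_le w
  have hw2 : ‖w.2‖ ≤ 1 := hw ▸ norm_snd_le w
  have hy1 := key (x.1 + (1 / 2 : ℝ) • w.1, (1 / 2 : ℝ) • w.2)
    (by
      simp only [phase, mem_prod, mem_univ, true_and, mem_ball_zero_iff, norm_smul]
      norm_num
      linarith)
    (by
      rw [Prod.norm_def]
      refine max_le ?_ ?_
      · simp only [Prod.fst_sub, add_sub_cancel_left, norm_smul]
        norm_num
        linarith
      · simp only [Prod.snd_sub]
        refine (norm_sub_le _ _).trans ?_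
        rw [norm_smul]
        norm_num
        linarith)
  have hy2 := key (x.1, 0) (by simp [phase]) (by
      rw [Prod.norm_def]
      refine max_le ?_ ?_
      · simp
      · simp only [Prod.snd_sub, zero_sub, norm_neg]
        linarith)
  have e : v' x w = (2 : ℝ) • (v' x ((x.1 + (1 / 2 : ℝ) • w.1, (1 / 2 : ℝ) • w.2) - x)
      - v' x ((x.1, 0) - x)) := by
    rw [← map_sub, ← map_smul]
    congr 1
    ext i <;> simp
  rw [e, norm_smul]
  have := norm_sub_le (v' x ((x.1 + (1 / 2 : ℝ) • w.1, (1 / 2 : ℝ) • w.2) - x))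
    (v' x ((x.1, 0) - x))
  rw [Real.norm_of_nonneg zero_le_two]
  linarith

/-- If functions with uniformly Lipschitz derivatives converge uniformly on `𝕋ⁿ × B₁`, then so do
their derivatives. -/
theorem uniformCauchySeqOn_fderiv {F ι : Type*} [NormedAddCommGroup F] [NormedSpace ℝ F]
    {l : Filter ι} {v : ι → E n × E n → F} {v' : ι → E n × E n → E n × E n →L[ℝ] F}
    {v₀ : E n × E n → F} {M : ℝ} (hM : 0 ≤ M)
    (hd : ∀ t, ∀ x ∈ phase (ball 0 1), HasFDerivAt (v t) (v' t x) x)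
    (hl : ∀ t, ∀ x ∈ phase (ball 0 1), ∀ y ∈ phase (ball 0 1),
      ‖v' t x - v' t y‖ ≤ M * ‖x - y‖)
    (hv : TendstoUniformlyOn v v₀ l (phase (ball 0 1))) :
    UniformCauchySeqOn v' l (phase (ball 0 1)) := by
  have hc := hv.uniformCauchySeqOn
  intro U hU
  obtain ⟨η, hη, hηU⟩ := Metric.mem_uniformity_dist.1 hU
  set r : ℝ := min 1 (η / (64 * (M + 1))) with hr
  have hr0 : 0 < r := by positivity
  have hrM : 64 * (M + 1) * r ≤ η := by
    have := min_le_right 1 (η / (64 * (M + 1)))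
    rw [← hr, le_div_iff₀ (by positivity)] at this
    linarith
  have hδ : 0 < η * r / 32 := by positivity
  filter_upwards [hc _ (Metric.dist_mem_uniformity hδ)] with t ht x hx
  refine hηU ?_
  have := norm_deriv_le_of_lipschitz (v := fun x => v t.1 x - v t.2 x)
    (v' := fun x => v' t.1 x - v' t.2 x) (δ := η * r / 32) (M := 2 * M) (r := r) (by positivity)
    hr0 (min_le_left _ _)
    (fun x hx => (hd _ x hx).sub (hd _ x hx))
    (fun x hx y hy => by
      have e : v' t.1 x - v' t.2 x - (v' t.1 y - v' t.2 y)
          = (v' t.1 x - v' t.1 y) - (v' t.2 x - v' t.2 y) := by abel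
      rw [e]
      linarith [norm_sub_le (v' t.1 x - v' t.1 y) (v' t.2 x - v' t.2 y), hl t.1 x hx y hy,
        hl t.2 x hx y hy])
    (fun x hx => by
      have := ht x hx
      rw [← dist_eq_norm]
      exact le_of_lt this) hx
  rw [dist_eq_norm]
  refine this.trans_lt ?_
  have e : 4 * (2 * (η * r / 32) / r + 4 * (2 * M) * r) = η / 4 + 32 * M * r := by
    field_simp
    ring
  rw [e]
  nlinarith

/-- Uniform limits of functions with bounded and Lipschitz derivatives are of the same kind, and
the derivatives converge uniformly. -/
theorem lipDeriv_of_tendstoUniformlyOn {ι : Type*} {l : Filter ι} [l.NeBot] {M : ℝ} (m : ℕ)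
    {F : Type} [NormedAddCommGroup F] [NormedSpace ℝ F] [CompleteSpace F]
    {v : ι → E n × E n → F} {v₀ : E n × E n → F}
    (hv : ∀ t, LipDeriv m M (phase (ball 0 1)) (v t))
    (hlim : TendstoUniformlyOn v v₀ l (phase (ball 0 1))) :
    LipDeriv m M (phase (ball 0 1)) v₀ ∧ ∀ j ≤ m,
      TendstoUniformlyOn (fun t => iteratedFDerivWithin ℝ j (v t) (phase (ball 0 1)))
        (iteratedFDerivWithin ℝ j v₀ (phase (ball 0 1))) l (phase (ball 0 1)) := by
  have hU := isOpen_phase (n := n)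
  have h0U : (0 : E n × E n) ∈ phase (ball (0 : E n) 1) := by simp [phase]
  obtain ⟨t₀⟩ := l.nonempty_of_neBot
  have hM : 0 ≤ M := (norm_nonneg _).trans ((hv t₀).1.norm_le h0U)
  have hzero {G : Type} [NormedAddCommGroup G] [NormedSpace ℝ G] {a : ι → E n × E n → G}
      {a₀ : E n × E n → G} (ha : TendstoUniformlyOn a a₀ l (phase (ball 0 1))) :
      TendstoUniformlyOn (fun t => iteratedFDerivWithin ℝ 0 (a t) (phase (ball 0 1)))
        (iteratedFDerivWithin ℝ 0 a₀ (phase (ball 0 1))) l (phase (ball 0 1)) := by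
    rw [Metric.tendstoUniformlyOn_iff] at ha ⊢
    intro η hη
    filter_upwards [ha η hη] with t ht x hx
    rw [dist_eq_norm, norm_iteratedFDerivWithin_zero_sub, ← dist_eq_norm]
    exact ht x hx
  have hpt : ∀ x ∈ phase (ball (0 : E n) 1), Tendsto (fun t => v t x) l (𝓝 (v₀ x)) :=
    fun x hx => hlim.tendsto_at hx
  have hb₀ : ∀ x ∈ phase (ball (0 : E n) 1), ‖v₀ x‖ ≤ M := fun x hx =>
    le_of_tendsto (hpt x hx).norm (Eventually.of_forall fun t => (hv t).1.norm_le hx)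
  induction m generalizing F with
  | zero =>
    refine ⟨⟨⟨contDiffOn_zero.2 ?_, fun j hj x hx => ?_⟩, fun x hx y hy => ?_⟩, fun j hj => ?_⟩
    · exact hlim.continuousOn (Frequently.of_forall fun t => (hv t).1.1.continuousOn)
    · obtain rfl : j = 0 := by lia
      simpa using hb₀ x hx
    · rw [norm_iteratedFDerivWithin_zero_sub]
      refine le_of_tendsto ((hpt x hx).sub (hpt y hy)).norm (Eventually.of_forall fun t => ?_)
      exact (hv t).norm_sub_le hU convex_phase hx hy
    · obtain rfl : j = 0 := by lia
      exact hzero hlim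
  | succ m ih =>
    have hd : ∀ t, ∀ x ∈ phase (ball (0 : E n) 1), HasFDerivAt (v t) (fderiv ℝ (v t) x) x :=
      fun t x hx => (hv t).1.hasFDerivAt hU hx
    have hv' : ∀ t, LipDeriv m M (phase (ball 0 1)) (fderiv ℝ (v t)) := fun t => (hv t).fderiv hU
    have hcau := uniformCauchySeqOn_fderiv hM hd
      (fun t x hx y hy => (hv' t).norm_sub_le hU convex_phase hx hy) hlim
    have hex : ∀ x, ∃ L, x ∈ phase (ball (0 : E n) 1) →
        Tendsto (fun t => fderiv ℝ (v t) x) l (𝓝 L) := by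
      intro x
      by_cases hx : x ∈ phase (ball (0 : E n) 1)
      · obtain ⟨L, hL⟩ := cauchy_map_iff_exists_tendsto.1 (hcau.cauchy_map hx)
        exact ⟨L, fun _ => hL⟩
      · exact ⟨0, fun h => absurd h hx⟩
    choose L hL using hex
    have hLu : TendstoUniformlyOn (fun t => fderiv ℝ (v t)) L l (phase (ball 0 1)) :=
      hcau.tendstoUniformlyOn_of_tendsto fun x hx => hL x hx
    have hd₀ : ∀ x ∈ phase (ball (0 : E n) 1), HasFDerivAt v₀ (L x) x := fun x hx =>
      hasFDerivAt_of_tendstoUniformlyOn hU hLu hd hpt hx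
    have hLu' : TendstoUniformlyOn (fun t => fderiv ℝ (v t)) (fderiv ℝ v₀) l
        (phase (ball 0 1)) := hLu.congr_right fun x hx => ((hd₀ x hx).fderiv).symm
    have hpt' : ∀ x ∈ phase (ball (0 : E n) 1),
        Tendsto (fun t => fderiv ℝ (v t) x) l (𝓝 (fderiv ℝ v₀ x)) :=
      fun x hx => hLu'.tendsto_at hx
    obtain ⟨h1, h2⟩ := ih hv' hLu' hpt' fun x hx => le_of_tendsto (hpt' x hx).norm
      (Eventually.of_forall fun t => (hv' t).1.norm_le hx)
    refine ⟨⟨BddDeriv.of_hasFDerivAt hU (fun x hx => ?_) hb₀ h1.1, fun x hx y hy => ?_⟩,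
      fun j hj => ?_⟩
    · exact (hd₀ x hx).differentiableAt.hasFDerivAt
    · rw [norm_iteratedFDerivWithin_succ_sub hU hx hy]
      exact h1.2 x hx y hy
    · rcases j with _ | j
      · exact hzero hlim
      · have := h2 j (by lia)
        rw [Metric.tendstoUniformlyOn_iff] at this ⊢
        intro η hη
        filter_upwards [this η hη] with t ht x hx
        rw [dist_eq_norm, norm_iteratedFDerivWithin_succ_sub hU hx hx, ← dist_eq_norm]
        exact ht x hx

end Interpolation

section HolderNorm

variable {V F ι : Type*} [NormedAddCommGroup V] [NormedSpace ℝ V]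
  [NormedAddCommGroup F] [NormedSpace ℝ F] {b : ι → V} {s : Set V} {f : V → F} {σ δ M : ℝ}

theorem norm_partial_le (hb : ∀ i, ‖b i‖ ≤ 1) {j : ℕ}
    (T : ContinuousMultilinearMap ℝ (fun _ : Fin j => V) F) (v : Fin j → ι) :
    ‖T fun a => b (v a)‖ ≤ ‖T‖ := by
  refine (T.le_opNorm _).trans ?_
  refine mul_le_of_le_one_right (norm_nonneg _) ?_
  exact Finset.prod_le_one (fun a _ => norm_nonneg _) fun a _ => hb _

theorem cNormOn_le (hb : ∀ i, ‖b i‖ ≤ 1) {k : ℕ}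
    (hf : ∀ j ≤ k, ∀ x ∈ s, ‖iteratedFDerivWithin ℝ j f s x‖ ≤ δ) :
    cNormOn b k s f ≤ ENNReal.ofReal δ := by
  refine iSup_le fun j => iSup_le fun hj => iSup_le fun v => iSup_le fun x => iSup_le fun hx => ?_
  rw [← ofReal_norm]
  exact ENNReal.ofReal_le_ofReal ((norm_partial_le hb _ v).trans (hf j hj x hx))

theorem holderSeminormOn_le (hb : ∀ i, ‖b i‖ ≤ 1) {k : ℕ} {μ : ℝ} (hμ0 : 0 ≤ μ) (hμ1 : μ ≤ 1)
    (hM : 0 ≤ M)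
    (hf : ∀ x ∈ s, ‖iteratedFDerivWithin ℝ k f s x‖ ≤ δ)
    (hl : ∀ x ∈ s, ∀ y ∈ s,
      ‖iteratedFDerivWithin ℝ k f s x - iteratedFDerivWithin ℝ k f s y‖ ≤ M * ‖x - y‖) :
    holderSeminormOn b k μ s f ≤ ENNReal.ofReal ((2 * δ) ^ (1 - μ) * M ^ μ) := by
  refine iSup_le fun v => iSup_le fun x => iSup_le fun hx => iSup_le fun y => iSup_le fun hy =>
    iSup_le fun hxy => ENNReal.ofReal_le_ofReal ?_
  have hd : 0 < ‖x - y‖ := norm_pos_iff.2 (sub_ne_zero.2 hxy)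
  rw [div_le_iff₀ (Real.rpow_pos_of_pos hd _)]
  have h0 : ‖partialOn b s f k v x - partialOn b s f k v y‖
      ≤ ‖iteratedFDerivWithin ℝ k f s x - iteratedFDerivWithin ℝ k f s y‖ :=
    norm_partial_le hb (iteratedFDerivWithin ℝ k f s x - iteratedFDerivWithin ℝ k f s y) v
  set a := ‖partialOn b s f k v x - partialOn b s f k v y‖
  have ha : 0 ≤ a := norm_nonneg _
  have h1 : a ≤ 2 * δ := by
    linarith [norm_sub_le (iteratedFDerivWithin ℝ k f s x) (iteratedFDerivWithin ℝ k f s y),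
      hf x hx, hf y hy]
  have h2 : a ≤ M * ‖x - y‖ := h0.trans (hl x hx y hy)
  have hδ : 0 ≤ δ := by linarith
  calc a = a ^ (1 - μ) * a ^ μ := by
        rw [← Real.rpow_add_of_nonneg ha (by linarith) hμ0]
        simp
    _ ≤ (2 * δ) ^ (1 - μ) * (M * ‖x - y‖) ^ μ := by
        have h3 : 0 ≤ 1 - μ := by linarith
        gcongr
    _ = (2 * δ) ^ (1 - μ) * M ^ μ * ‖x - y‖ ^ μ := by
        rw [Real.mul_rpow hM hd.le, mul_assoc]

theorem holderNormOn_le (hσ : 0 ≤ σ) (hb : ∀ i, ‖b i‖ ≤ 1) (hδ : 0 ≤ δ) (hM : 0 ≤ M)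
    (hf : ∀ j ≤ ⌊σ⌋₊, ∀ x ∈ s, ‖iteratedFDerivWithin ℝ j f s x‖ ≤ δ)
    (hl : ∀ x ∈ s, ∀ y ∈ s,
      ‖iteratedFDerivWithin ℝ ⌊σ⌋₊ f s x - iteratedFDerivWithin ℝ ⌊σ⌋₊ f s y‖ ≤ M * ‖x - y‖) :
    holderNormOn b σ s f
      ≤ ENNReal.ofReal (δ + (2 * δ) ^ (1 - (σ - ⌊σ⌋₊)) * M ^ (σ - ⌊σ⌋₊)) := by
  rw [ENNReal.ofReal_add hδ (by positivity)]
  refine add_le_add (cNormOn_le hb hf) ?_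
  split_ifs
  · exact zero_le
  · exact holderSeminormOn_le hb (by linarith [Nat.floor_le hσ])
      (by linarith [Nat.lt_floor_add_one σ]) hM (hf _ le_rfl) hl

theorem LipDeriv.holderOn (hσ : 0 ≤ σ) (hb : ∀ i, ‖b i‖ ≤ 1) (hM : 0 ≤ M)
    (hf : LipDeriv ⌊σ⌋₊ M s f) : HolderOn b σ s f :=
  ⟨hf.1.1, (holderNormOn_le hσ hb hM hM hf.1.2 hf.2).trans_lt ENNReal.ofReal_lt_top⟩

/-- Convergence to `0` of the Hölder norms of functions whose derivatives converge uniformly and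
are uniformly Lipschitz. -/
theorem tendsto_holderNormOn {α : Type*} {l : Filter α} {f : α → V → F} (hσ : 0 ≤ σ)
    (hb : ∀ i, ‖b i‖ ≤ 1) (hM : 0 ≤ M)
    (hf : ∀ j ≤ ⌊σ⌋₊, ∀ η : ℝ, 0 < η → ∀ᶠ t in l, ∀ x ∈ s,
      ‖iteratedFDerivWithin ℝ j (f t) s x‖ ≤ η)
    (hl : ∀ t, ∀ x ∈ s, ∀ y ∈ s,
      ‖iteratedFDerivWithin ℝ ⌊σ⌋₊ (f t) s x - iteratedFDerivWithin ℝ ⌊σ⌋₊ (f t) s y‖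
        ≤ M * ‖x - y‖) :
    Tendsto (fun t => holderNormOn b σ s (f t)) l (𝓝 0) := by
  have hμ : 0 < 1 - (σ - ⌊σ⌋₊) := by linarith [Nat.lt_floor_add_one σ]
  have hcont : Tendsto (fun δ : ℝ => δ + (2 * δ) ^ (1 - (σ - ⌊σ⌋₊)) * M ^ (σ - ⌊σ⌋₊))
      (𝓝 0) (𝓝 0) := by
    have h1 : ContinuousAt
        (fun δ : ℝ => δ + (2 * δ) ^ (1 - (σ - ⌊σ⌋₊)) * M ^ (σ - ⌊σ⌋₊)) 0 := by
      refine continuousAt_id.add (ContinuousAt.mul ?_ continuousAt_const)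
      exact ContinuousAt.rpow_const (by fun_prop) (Or.inr hμ.le)
    have h2 := h1.tendsto
    simpa [Real.zero_rpow hμ.ne'] using h2
  rw [ENNReal.tendsto_nhds_zero]
  intro ε hε
  by_cases hεt : ε = ⊤
  · simp [hεt]
  have hε' : 0 < ε.toReal := ENNReal.toReal_pos hε.ne' hεt
  have h1 : ∀ᶠ δ in 𝓝[>] (0 : ℝ),
      δ + (2 * δ) ^ (1 - (σ - ⌊σ⌋₊)) * M ^ (σ - ⌊σ⌋₊) < ε.toReal :=
    (hcont.mono_left nhdsWithin_le_nhds).eventually (gt_mem_nhds hε')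
  obtain ⟨δ, hδ, hδ0⟩ := (h1.and self_mem_nhdsWithin).exists
  have h2 : ∀ᶠ t in l, ∀ j ∈ Finset.range (⌊σ⌋₊ + 1), ∀ x ∈ s,
      ‖iteratedFDerivWithin ℝ j (f t) s x‖ ≤ δ := by
    rw [Filter.eventually_all_finset]
    intro j hj
    exact hf j (by simpa [Nat.lt_succ_iff] using hj) δ hδ0
  filter_upwards [h2] with t ht
  refine (holderNormOn_le hσ hb (le_of_lt hδ0) hM
    (fun j hj => ht j (by simpa [Nat.lt_succ_iff] using hj)) (hl t)).trans ?_
  exact ENNReal.ofReal_le_of_le_toReal hδ.le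

end HolderNorm

section FromCoordinates

variable {V F ι : Type*} [NormedAddCommGroup V] [NormedSpace ℝ V]
  [NormedAddCommGroup F] [NormedSpace ℝ F] [Fintype ι] {b : ι → V} {c : V → ι → ℝ}

/-- The operator norm of a multilinear map is controlled by its values on a basis. -/
theorem opNorm_le_of_basis (hc : ∀ x, x = ∑ i, c x i • b i) (hcn : ∀ x i, |c x i| ≤ ‖x‖) {j : ℕ}
    {C : ℝ} (hC : 0 ≤ C) (T : ContinuousMultilinearMap ℝ (fun _ : Fin j => V) F)
    (hT : ∀ v : Fin j → ι, ‖T fun a => b (v a)‖ ≤ C) :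
    ‖T‖ ≤ (Fintype.card ι : ℝ) ^ j * C := by
  classical
  refine T.opNorm_le_bound (by positivity) fun x => ?_
  have e : T x = ∑ v : Fin j → ι, (∏ a, c (x a) (v a)) • T fun a => b (v a) := by
    conv_lhs => rw [show x = fun a => ∑ i, c (x a) i • b i from funext fun a => hc (x a)]
    rw [T.map_sum]
    exact Finset.sum_congr rfl fun v _ => T.map_smul_univ _ _
  rw [e]
  calc ‖∑ v : Fin j → ι, (∏ a, c (x a) (v a)) • T fun a => b (v a)‖
      ≤ ∑ v : Fin j → ι, (∏ a, ‖x a‖) * C := by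
        refine norm_sum_le_of_le _ fun v _ => ?_
        rw [norm_smul, Real.norm_eq_abs, Finset.abs_prod]
        exact mul_le_mul (Finset.prod_le_prod (fun _ _ => abs_nonneg _) fun a _ => hcn _ _)
          (hT v) (norm_nonneg _) (Finset.prod_nonneg fun a _ => norm_nonneg _)
    _ = (Fintype.card ι : ℝ) ^ j * C * ∏ a, ‖x a‖ := by
        simp
        ring

theorem BddDeriv.of_holderNormOn (hc : ∀ x, x = ∑ i, c x i • b i)
    (hcn : ∀ x i, |c x i| ≤ ‖x‖) {σ C : ℝ} (hC : 0 ≤ C) {s : Set V} {f : V → F}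
    (hf : ContDiffOn ℝ ⌊σ⌋₊ f s) (hn : holderNormOn b σ s f ≤ ENNReal.ofReal C) :
    BddDeriv ⌊σ⌋₊ ((Fintype.card ι + 1 : ℝ) ^ ⌊σ⌋₊ * C) s f := by
  refine ⟨hf, fun j hj x hx => ?_⟩
  have h1 : ∀ v : Fin j → ι, ‖iteratedFDerivWithin ℝ j f s x fun a => b (v a)‖ ≤ C := by
    intro v
    have h2 : ‖partialOn b s f j v x‖ₑ ≤ ENNReal.ofReal C := by
      refine le_trans ?_ ((le_add_right le_rfl).trans hn)
      exact le_iSup_of_le j <| le_iSup_of_le hj <| le_iSup_of_le v <| le_iSup_of_le x <|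
        le_iSup_of_le hx le_rfl
    rw [← ofReal_norm] at h2
    exact (ENNReal.ofReal_le_ofReal_iff hC).1 h2
  refine (opNorm_le_of_basis hc hcn hC _ h1).trans ?_
  gcongr
  calc (Fintype.card ι : ℝ) ^ j ≤ (Fintype.card ι + 1 : ℝ) ^ j := by gcongr; linarith
    _ ≤ (Fintype.card ι + 1 : ℝ) ^ ⌊σ⌋₊ :=
      pow_le_pow_right₀ (by linarith [Nat.cast_nonneg (α := ℝ) (Fintype.card ι)]) hj

end FromCoordinates

section Coordinates

variable {n : ℕ}

theorem norm_e (i : Fin n) : ‖(e i : E n)‖ = 1 := by simp [e]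

theorem norm_e2 (i : Fin n ⊕ Fin n) : ‖(e2 i : E n × E n)‖ ≤ 1 := by
  rcases i with i | i <;> simp [e2, Prod.norm_def, norm_e]

theorem sum_smul_e (x : E n) : x = ∑ i, x i • e i := by
  ext j
  simp [e, Finset.sum_apply, Pi.single_apply]

theorem abs_apply_le (x : E n) (i : Fin n) : |x i| ≤ ‖x‖ := PiLp.norm_apply_le x i

theorem sum_smul_e2 (x : E n × E n) : x = ∑ i, Sum.elim (⇑x.1) (⇑x.2) i • e2 i := by
  rw [Fintype.sum_sum_type]
  ext1
  · simpa [e2, Prod.fst_sum] using sum_smul_e x.1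
  · simpa [e2, Prod.snd_sum] using sum_smul_e x.2

theorem abs_elim_le (x : E n × E n) (i : Fin n ⊕ Fin n) : |Sum.elim (⇑x.1) (⇑x.2) i| ≤ ‖x‖ := by
  rcases i with i | i
  · exact (abs_apply_le x.1 i).trans (norm_fst_le x)
  · exact (abs_apply_le x.2 i).trans (norm_snd_le x)

theorem norm_le_of_abs_apply_le {x : E n} {C : ℝ} (hC : ∀ i, |x i| ≤ C) : ‖x‖ ≤ n * C := by
  conv_lhs => rw [sum_smul_e x]
  calc ‖∑ i, x i • (e i : E n)‖ ≤ ∑ _i : Fin n, C := by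
        refine norm_sum_le_of_le _ fun i _ => ?_
        rw [norm_smul, norm_e, mul_one]
        exact hC i
    _ = n * C := by simp

/-- A function with values in linear forms is controlled by its components. -/
theorem BddDeriv.of_components {V G : Type*} [NormedAddCommGroup V] [NormedSpace ℝ V]
    [NormedAddCommGroup G] [NormedSpace ℝ G] {m : ℕ} {M : ℝ} (hM : 0 ≤ M) {s : Set V}
    (hs : UniqueDiffOn ℝ s) {u : V → E n →L[ℝ] G}
    (hu : ∀ i, BddDeriv m M s (fun x => u x (e i))) : BddDeriv m (n * M) s u := by
  let L : Fin n → G →L[ℝ] (E n →L[ℝ] G) := fun i =>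
    ContinuousLinearMap.smulRightL ℝ (E n) G (EuclideanSpace.proj i)
  have hL : ∀ i, ‖L i‖ ≤ 1 := by
    intro i
    refine (L i).opNorm_le_bound zero_le_one fun y => ?_
    refine (L i y).opNorm_le_bound (by positivity) fun x => ?_
    change ‖x i • y‖ ≤ _
    rw [norm_smul, one_mul, mul_comm]
    gcongr
    exact abs_apply_le x i
  have h := BddDeriv.sum hs Finset.univ (M := M) (f := fun i x => L i (u x (e i)))
    fun i _ => ((hu i).clm_comp hs (L i)).mono (mul_le_of_le_one_left hM (hL i))
  simp only [Finset.card_univ, Fintype.card_fin] at h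
  refine h.congr fun x _ => ?_
  ext y
  conv_lhs => rw [sum_smul_e y]
  simp [L]

end Coordinates

section WeightedNorms

variable {n : ℕ} {σ l : ℝ} {A : Set (E n)} {g : E n → E n → ℝ → ℝ}

theorem holderNormOn_mul_le_wnormB {p : E n} (hp : p ∈ A) (t : ℝ) :
    holderNormOn e σ univ (fun q => g q p t) * ENNReal.ofReal (w1 l t) ≤ wnormB σ l A g :=
  le_add_right (le_iSup_of_le p <| le_iSup_of_le hp <| le_iSup_of_le t le_rfl)

theorem wnormB_le_wnormBbar (k : ℕ) : wnormB (σ + k) l A g ≤ wnormBbar σ k l A g := by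
  refine le_iSup_of_le [] (le_iSup_of_le (by simp) ?_)
  simp [dqs]

theorem enorm_le_holderNormOn (g : E n → ℝ) (q : E n) : ‖g q‖ₑ ≤ holderNormOn e σ univ g := by
  refine le_trans ?_ (le_add_right le_rfl)
  refine le_iSup_of_le 0 <| le_iSup_of_le (Nat.zero_le _) <| le_iSup_of_le Fin.elim0 <|
    le_iSup_of_le q <| le_iSup_of_le (mem_univ q) ?_
  simp [partialOn]

theorem one_le_w1 (l t : ℝ) : 1 ≤ w1 l t := by
  unfold w1
  split_ifs
  · exact le_rfl
  · linarith [Real.rpow_nonneg (abs_nonneg t) l]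

theorem holderNormOn_le_wnormB {p : E n} (hp : p ∈ A) (t : ℝ) :
    holderNormOn e σ univ (fun q => g q p t) ≤ wnormB σ l A g := by
  refine le_trans ?_ (holderNormOn_mul_le_wnormB (l := l) hp t)
  refine le_mul_of_one_le_right zero_le ?_
  simpa using ENNReal.ofReal_le_ofReal (one_le_w1 l t)

theorem abs_le_of_wnormB_le {ε : ℝ} (hε : 0 ≤ ε) (h : wnormB σ l A g ≤ ENNReal.ofReal ε)
    (q : E n) {p : E n} (hp : p ∈ A) (t : ℝ) : |g q p t| ≤ ε / w1 l t := by
  have hw : 0 < w1 l t := zero_lt_one.trans_le (one_le_w1 l t)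
  rw [le_div_iff₀ hw]
  have h1 : ‖g q p t‖ₑ * ENNReal.ofReal (w1 l t) ≤ ENNReal.ofReal ε :=
    le_trans (mul_le_mul_left (enorm_le_holderNormOn (σ := σ) (fun q => g q p t) q) _)
      ((holderNormOn_mul_le_wnormB hp t).trans h)
  rw [← ofReal_norm, ← ENNReal.ofReal_mul (norm_nonneg _)] at h1
  exact (ENNReal.ofReal_le_ofReal_iff hε).1 h1

end WeightedNorms

section Perturbed

variable {n : ℕ} {σ Υ l ε : ℝ} {h : E n → ℝ} {f : E n → E n → ℝ → ℝ}

theorem IsPerturbed.wnormB_f_le (hH : IsPerturbed σ Υ l ε h f) :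
    wnormB (σ + 2) 0 (ball 0 1) f ≤ ENNReal.ofReal ε :=
  le_trans (le_add_right (le_add_right le_rfl)) hH.small.le

theorem IsPerturbed.wnormB_dq_le (hH : IsPerturbed σ Υ l ε h f) (i : Fin n) :
    wnormB (σ + 1) (l + 2) (ball 0 1) (dq i f) ≤ ENNReal.ofReal ε := by
  refine le_trans ?_ hH.small.le
  refine le_trans ?_ (le_add_right (le_add_left le_rfl))
  refine le_iSup_of_le i ?_
  simpa using wnormB_le_wnormBbar (σ := σ) (l := l + 2) (A := ball 0 1) (g := dq i f) 1

theorem IsPerturbed.wnormB_dp_le (hH : IsPerturbed σ Υ l ε h f) (i : Fin n) :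
    wnormB (σ + 2) (l + 1) (ball 0 1) (dp i f) ≤ ENNReal.ofReal ε := by
  refine le_trans ?_ hH.small.le
  refine le_trans ?_ (le_add_left le_rfl)
  refine le_iSup_of_le i ?_
  simpa using wnormB_le_wnormBbar (σ := σ) (l := l + 1) (A := ball 0 1) (g := dp i f) 2

theorem IsPerturbed.abs_dq_le (hH : IsPerturbed σ Υ l ε h f) (hl : 1 < l) (hε : 0 < ε)
    (i : Fin n) (q : E n) {p : E n} (hp : p ∈ ball (0 : E n) 1) (t : ℝ) :
    |dq i f q p t| ≤ ε / (1 + |t| ^ (l + 2)) := by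
  have := abs_le_of_wnormB_le hε.le (hH.wnormB_dq_le i) q hp t
  rwa [w1, if_neg (by linarith)] at this

theorem IsPerturbed.abs_dp_le (hH : IsPerturbed σ Υ l ε h f) (hl : 1 < l) (hε : 0 < ε)
    (i : Fin n) (q : E n) {p : E n} (hp : p ∈ ball (0 : E n) 1) (t : ℝ) :
    |dp i f q p t| ≤ ε / (1 + |t| ^ (l + 1)) := by
  have := abs_le_of_wnormB_le hε.le (hH.wnormB_dp_le i) q hp t
  rwa [w1, if_neg (by linarith)] at this

theorem IsPerturbed.memB_f (hH : IsPerturbed σ Υ l ε h f) : MemB (σ + 2) (ball 0 1) f := by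
  simpa [dqs] using hH.f_mem [] (by simp)

theorem IsPerturbed.memB_dq (hH : IsPerturbed σ Υ l ε h f) (i : Fin n) :
    MemB (σ + 1) (ball 0 1) (dq i f) := by
  have h1 := hH.f_mem [i] (by simp)
  have e : σ + (2 : ℕ) - (([i] : List (Fin n)).length : ℝ) = σ + 1 := by
    simp
    ring
  rw [e] at h1
  simpa [dqs] using h1

theorem IsPerturbed.memB_dp (hH : IsPerturbed σ Υ l ε h f) (i : Fin n) :
    MemB (σ + 2) (ball 0 1) (dp i f) := by
  simpa [dqs] using hH.dpf_mem i [] (by simp)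

theorem IsPerturbed.differentiableAt_h (hH : IsPerturbed σ Υ l ε h f) {p : E n}
    (hp : p ∈ ball (0 : E n) 1) : DifferentiableAt ℝ h p :=
  (hH.h_smooth.differentiableOn (by simp) p hp).differentiableAt (isOpen_ball.mem_nhds hp)

theorem IsPerturbed.contDiffOn_fderiv_h (hH : IsPerturbed σ Υ l ε h f) :
    ContDiffOn ℝ 1 (fderiv ℝ h) (ball 0 1) :=
  hH.h_smooth.fderiv_of_isOpen isOpen_ball (by norm_num)

theorem IsPerturbed.dp_ham (hH : IsPerturbed σ Υ l ε h f) (i : Fin n) (q : E n) {p : E n}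
    (hp : p ∈ ball (0 : E n) 1) (t : ℝ) :
    dp i (ham h f) q p t = fderiv ℝ h p (e i) + dp i f q p t := by
  unfold dp ham
  rw [fderiv_fun_add (hH.differentiableAt_h hp) (hH.memB_f.diff q p hp t)]
  rfl

theorem dq_ham (i : Fin n) (q p : E n) (t : ℝ) : dq i (ham h f) q p t = dq i f q p t := by
  unfold dq ham
  rw [fderiv_const_add]

theorem abs_fderiv_le_of_freqNorm {K : ℝ} (hK : freqNorm h ≤ ENNReal.ofReal K) (i : Fin n)
    {p : E n} (hp : p ∈ ball (0 : E n) 1) : |fderiv ℝ h p (e i)| ≤ max K 0 := by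
  have h1 : ‖fderiv ℝ h p (e i)‖ₑ ≤ freqNorm h := by
    refine le_iSup_of_le i <| le_iSup_of_le 0 <| le_iSup_of_le zero_le_one <|
      le_iSup_of_le Fin.elim0 <| le_iSup_of_le p <| le_iSup_of_le hp ?_
    simp [partialOn]
  have h2 := h1.trans (hK.trans (ENNReal.ofReal_le_ofReal (le_max_left K 0)))
  rw [← ofReal_norm] at h2
  exact (ENNReal.ofReal_le_ofReal_iff (le_max_right K 0)).1 h2

theorem norm_fderiv_le_of_freqNorm {K : ℝ} (hK : freqNorm h ≤ ENNReal.ofReal K)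
    {p : E n} (hp : p ∈ ball (0 : E n) 1) : ‖fderiv ℝ h p‖ ≤ n * max K 0 := by
  refine (fderiv ℝ h p).opNorm_le_bound (by positivity) fun x => ?_
  conv_lhs => rw [sum_smul_e x]
  rw [map_sum]
  calc ‖∑ i, fderiv ℝ h p (x i • e i)‖ ≤ ∑ _i : Fin n, max K 0 * ‖x‖ := by
        refine norm_sum_le_of_le _ fun i _ => ?_
        rw [map_smul, norm_smul, mul_comm]
        gcongr
        · exact abs_fderiv_le_of_freqNorm hK i hp
        · exact abs_apply_le x i
    _ = n * max K 0 * ‖x‖ := by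
        simp
        ring

/-- The functions `∂_p H^t` are of class `C^{σ+2}` in `(q, p)`, with derivatives bounded uniformly
in `t`. -/
theorem IsPerturbed.bddDeriv_dp (hH : IsPerturbed σ Υ l ε h f) (hσ : 1 ≤ σ) (hε : 0 < ε)
    (hΥ : 1 ≤ Υ) {K : ℝ} (hK : freqNorm h ≤ ENNReal.ofReal K) :
    ∃ M : ℝ, 0 ≤ M ∧ ∀ (t : ℝ) (j : Fin n), BddDeriv (⌊σ⌋₊ + 2) M (phase (ball 0 1))
      (fun x : E n × E n => dp j (ham h f) x.1 x.2 t) := by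
  have hfl : ⌊σ + 2⌋₊ = ⌊σ⌋₊ + 2 := Nat.floor_add_ofNat (by linarith) 2
  set M₁ : ℝ := (Fintype.card (Fin n) + 1 : ℝ) ^ ⌊σ + 2⌋₊ * ε with hM₁
  set M₂ : ℝ := (Fintype.card (Fin n ⊕ Fin n) + 1 : ℝ) ^ ⌊σ + 2⌋₊ * Υ with hM₂
  have hM₁0 : 0 ≤ M₁ := by positivity
  have hM₂0 : 0 ≤ M₂ := by positivity
  have hK0 : 0 ≤ max K 0 := le_max_right _ _
  set M : ℝ := max K 0 + M₁ + n * M₂ with hM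
  refine ⟨(((⌊σ + 2⌋₊ : ℕ) : ℝ) + 1) * M, by positivity, fun t j => ?_⟩
  rw [← hfl]
  have hU := isOpen_phase (n := n)
  refine bddDeriv_uncurry isOpen_ball (convex_ball 0 1) ⌊σ + 2⌋₊
    (u := fun q p => dp j (ham h f) q p t)
    (v := fun q p => fderiv ℝ (fun p' => dp j (ham h f) q p' t) p) (fun p hp => ?_)
    (fun q p hp => ?_) ?_
  · have h1 : BddDeriv ⌊σ + 2⌋₊ M₁ univ (fun q => dp j f q p t) :=
      BddDeriv.of_holderNormOn sum_smul_e abs_apply_le hε.le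
        ((hH.memB_dp j).holder p hp t).1 ((holderNormOn_le_wnormB hp t).trans (hH.wnormB_dp_le j))
    have h2 := (bddDeriv_const hK0 (fderiv ℝ h p (e j)) (abs_fderiv_le_of_freqNorm hK j hp)).add
      uniqueDiffOn_univ h1
    refine (h2.congr fun q _ => hH.dp_ham j q hp t).mono ?_
    rw [hM]
    nlinarith [mul_nonneg (Nat.cast_nonneg (α := ℝ) n) hM₂0]
  · refine DifferentiableAt.hasFDerivAt ?_
    have h1 : DifferentiableAt ℝ (fun p' => fderiv ℝ h p' (e j) + dp j f q p' t) p := by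
      refine DifferentiableAt.add ?_ ((hH.memB_dp j).diff q p hp t)
      exact ((hH.contDiffOn_fderiv_h.differentiableOn (by simp) p hp).differentiableAt
        (isOpen_ball.mem_nhds hp)).clm_apply (differentiableAt_const _)
    refine h1.congr_of_eventuallyEq ?_
    filter_upwards [isOpen_ball.mem_nhds hp] with p' hp' using hH.dp_ham j q hp' t
  · have h1 : BddDeriv ⌊σ + 2⌋₊ (n * M₂) (phase (ball 0 1)) (fun x : E n × E n =>
        fderiv ℝ (fun p' => dp j (ham h f) x.1 p' t) x.2) := by
      refine BddDeriv.of_components hM₂0 hU.uniqueDiffOn fun i => ?_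
      refine BddDeriv.of_holderNormOn sum_smul_e2 abs_elim_le (by linarith)
        (hH.hess_mem t i j).1 (le_trans ?_ hH.hess_bound)
      exact le_iSup_of_le t <| le_iSup_of_le i <| le_iSup_of_le j le_rfl
    refine h1.mono ?_
    rw [hM]
    linarith

/-- The Hamiltonians `H^t` are of class `C^{σ+2}` in `(q, p)`, with derivatives bounded uniformly
in `t`. -/
theorem IsPerturbed.bddDeriv_ham (hH : IsPerturbed σ Υ l ε h f) (hσ : 1 ≤ σ) (hε : 0 < ε)
    (hΥ : 1 ≤ Υ) {K : ℝ} (hK : freqNorm h ≤ ENNReal.ofReal K) :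
    ∃ M : ℝ, 0 ≤ M ∧ ∀ t : ℝ, BddDeriv (⌊σ⌋₊ + 2) M (phase (ball 0 1))
      (fun x : E n × E n => ham h f x.1 x.2 t) := by
  obtain ⟨M₀, hM₀, hdp⟩ := hH.bddDeriv_dp hσ hε hΥ hK
  have hfl : ⌊σ + 2⌋₊ = ⌊σ⌋₊ + 2 := Nat.floor_add_ofNat (by linarith) 2
  set M₁ : ℝ := (Fintype.card (Fin n) + 1 : ℝ) ^ ⌊σ + 2⌋₊ * ε with hM₁
  have hM₁0 : 0 ≤ M₁ := by positivity
  have hK0 : 0 ≤ max K 0 := le_max_right _ _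
  have hhb : ∀ p ∈ ball (0 : E n) 1, ‖h p‖ ≤ ‖h 0‖ + n * max K 0 := by
    intro p hp
    have h1 := (convex_ball (0 : E n) 1).norm_image_sub_le_of_norm_hasFDerivWithin_le
      (fun x hx => (hH.differentiableAt_h hx).hasFDerivAt.hasFDerivWithinAt)
      (fun x hx => norm_fderiv_le_of_freqNorm hK hx) (mem_ball_self one_pos) hp
    have h2 : ‖p - 0‖ ≤ 1 := by simpa using (mem_ball_zero_iff.1 hp).le
    have h3 : n * max K 0 * ‖p - 0‖ ≤ n * max K 0 := mul_le_of_le_one_right (by positivity) h2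
    linarith [norm_sub_norm_le (h p) (h 0)]
  set M : ℝ := ‖h 0‖ + n * max K 0 + M₁ + n * M₀ with hM
  refine ⟨(((⌊σ⌋₊ + 2 : ℕ) : ℝ) + 1) * M, by positivity, fun t => ?_⟩
  have hU := isOpen_phase (n := n)
  refine bddDeriv_uncurry isOpen_ball (convex_ball 0 1) (⌊σ⌋₊ + 2)
    (u := fun q p => ham h f q p t)
    (v := fun q p => fderiv ℝ (fun p' => ham h f q p' t) p) (fun p hp => ?_)
    (fun q p hp => ?_) ?_
  · have h1 : BddDeriv ⌊σ + 2⌋₊ M₁ univ (fun q => f q p t) :=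
      BddDeriv.of_holderNormOn sum_smul_e abs_apply_le hε.le
        (hH.memB_f.holder p hp t).1 ((holderNormOn_le_wnormB hp t).trans hH.wnormB_f_le)
    rw [hfl] at h1
    have h2 := (bddDeriv_const (by positivity) (h p) (hhb p hp)).add uniqueDiffOn_univ h1
    refine h2.mono ?_
    rw [hM]
    linarith [mul_nonneg (Nat.cast_nonneg (α := ℝ) n) hM₀]
  · exact ((hH.differentiableAt_h hp).add (hH.memB_f.diff q p hp t)).hasFDerivAt
  · have h1 : BddDeriv (⌊σ⌋₊ + 2) (n * M₀) (phase (ball 0 1)) (fun x : E n × E n =>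
        fderiv ℝ (fun p' => ham h f x.1 p' t) x.2) :=
      BddDeriv.of_components hM₀ hU.uniqueDiffOn fun i => hdp t i
    refine h1.mono ?_
    rw [hM]
    linarith [norm_nonneg (h 0), mul_nonneg (Nat.cast_nonneg (α := ℝ) n) hK0]

/-- The linear map that takes the differential of a Hamiltonian to its Hamiltonian vector field. -/
def symp (n : ℕ) : ((E n × E n) →L[ℝ] ℝ) →L[ℝ] E n × E n :=
  ∑ i : Fin n,
    ((ContinuousLinearMap.apply ℝ ℝ ((0, e i) : E n × E n)).smulRight ((e i, 0) : E n × E n)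
      - (ContinuousLinearMap.apply ℝ ℝ ((e i, 0) : E n × E n)).smulRight ((0, e i) : E n × E n))

theorem XH_eq_symp {H : E n → E n → ℝ → ℝ} {q p : E n} {t : ℝ}
    (hd : DifferentiableAt ℝ (fun x : E n × E n => H x.1 x.2 t) (q, p)) :
    XH H q p t = symp n (fderiv ℝ (fun x : E n × E n => H x.1 x.2 t) (q, p)) := by
  have hp : ∀ i, dp i H q p t = fderiv ℝ (fun x : E n × E n => H x.1 x.2 t) (q, p) (0, e i) := by
    intro i
    have := HasFDerivAt.comp (f := fun p' => (q, p')) p hd.hasFDerivAt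
      (hasFDerivAt_prodMk_right q p)
    unfold dp
    change fderiv ℝ ((fun x : E n × E n => H x.1 x.2 t) ∘ fun p' => (q, p')) p (e i) = _
    rw [this.fderiv]
    simp
  have hq : ∀ i, dq i H q p t = fderiv ℝ (fun x : E n × E n => H x.1 x.2 t) (q, p) (e i, 0) := by
    intro i
    have := HasFDerivAt.comp (f := fun q' => (q', p)) q hd.hasFDerivAt
      (hasFDerivAt_prodMk_left q p)
    unfold dq
    change fderiv ℝ ((fun x : E n × E n => H x.1 x.2 t) ∘ fun q' => (q', p)) q (e i) = _
    rw [this.fderiv]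
    simp
  simp only [XH, hp, hq, symp]
  ext i <;> simp [Prod.fst_sum, Prod.snd_sum, e, Pi.single_apply, Finset.sum_apply]

theorem IsPerturbed.bddDeriv_XH (hH : IsPerturbed σ Υ l ε h f) (hσ : 1 ≤ σ) (hε : 0 < ε)
    (hΥ : 1 ≤ Υ) {K : ℝ} (hK : freqNorm h ≤ ENNReal.ofReal K) :
    ∃ M : ℝ, 0 ≤ M ∧ ∀ t : ℝ, BddDeriv (⌊σ⌋₊ + 1) M (phase (ball 0 1))
      (fun x : E n × E n => XH (ham h f) x.1 x.2 t) := by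
  obtain ⟨M, hM, hb⟩ := hH.bddDeriv_ham hσ hε hΥ hK
  have hU := isOpen_phase (n := n)
  refine ⟨‖symp n‖ * M, by positivity, fun t => ?_⟩
  refine (((hb t).fderiv hU).clm_comp hU.uniqueDiffOn (symp n)).congr fun x hx => ?_
  exact XH_eq_symp ((hb t).hasFDerivAt hU hx).differentiableAt

/-- The integrable Hamiltonian `h`, as a time-dependent Hamiltonian. -/
def integrable (h : E n → ℝ) : E n → E n → ℝ → ℝ := fun _ p _ => h p

/-- The frequency map `∂_p h`. -/
def freq (h : E n → ℝ) (p : E n) : E n := WithLp.toLp 2 fun i => fderiv ℝ h p (e i)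

theorem XH_integrable (h : E n → ℝ) (q p : E n) (t : ℝ) :
    XH (integrable h) q p t = (freq h p, 0) := by
  ext i <;> simp [XH, integrable, dp, dq, freq]

theorem IsPerturbed.XH_ham (hH : IsPerturbed σ Υ l ε h f) (q : E n) {p : E n}
    (hp : p ∈ ball (0 : E n) 1) (t : ℝ) :
    XH (ham h f) q p t = (freq h p + WithLp.toLp 2 fun i => dp i f q p t,
      WithLp.toLp 2 fun i => -dq i f q p t) := by
  simp only [XH, dq_ham, hH.dp_ham _ q hp t]
  rfl

theorem IsPerturbed.norm_dq_le (hH : IsPerturbed σ Υ l ε h f) (hl : 1 < l) (hε : 0 < ε)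
    (q : E n) {p : E n} (hp : p ∈ ball (0 : E n) 1) (t : ℝ) :
    ‖(WithLp.toLp 2 fun i => -dq i f q p t : E n)‖ ≤ n * (ε / (1 + |t| ^ (l + 2))) :=
  norm_le_of_abs_apply_le fun i => by simpa using hH.abs_dq_le hl hε i q hp t

theorem IsPerturbed.norm_dp_le (hH : IsPerturbed σ Υ l ε h f) (hl : 1 < l) (hε : 0 < ε)
    (q : E n) {p : E n} (hp : p ∈ ball (0 : E n) 1) (t : ℝ) :
    ‖(WithLp.toLp 2 fun i => dp i f q p t : E n)‖ ≤ n * (ε / (1 + |t| ^ (l + 1))) :=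
  norm_le_of_abs_apply_le fun i => by simpa using hH.abs_dp_le hl hε i q hp t

theorem tendsto_weight {F : Filter ℝ} (hF : Tendsto (fun t : ℝ => |t|) F atTop) {a : ℝ}
    (ha : 0 < a) (c : ℝ) : Tendsto (fun t : ℝ => c / (1 + |t| ^ a)) F (𝓝 0) :=
  tendsto_const_nhds.div_atTop
    (tendsto_atTop_add_const_left _ _ ((tendsto_rpow_atTop ha).comp hF))

theorem IsPerturbed.tendstoUniformlyOn (hH : IsPerturbed σ Υ l ε h f) (hl : 1 < l) (hε : 0 < ε)
    {F : Filter ℝ} (hF : Tendsto (fun t : ℝ => |t|) F atTop) :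
    TendstoUniformlyOn (fun (t : ℝ) (x : E n × E n) => XH (ham h f) x.1 x.2 t)
      (fun x => (freq h x.2, 0)) F (phase (ball 0 1)) := by
  rw [Metric.tendstoUniformlyOn_iff]
  intro η hη
  have h1 := (tendsto_weight hF (a := l + 2) (by linarith) ε).const_mul (n : ℝ)
  have h2 := (tendsto_weight hF (a := l + 1) (by linarith) ε).const_mul (n : ℝ)
  rw [mul_zero] at h1 h2
  filter_upwards [h1.eventually (gt_mem_nhds hη), h2.eventually (gt_mem_nhds hη)] with t ht1 ht2 x hx
  rw [dist_comm, dist_eq_norm, hH.XH_ham x.1 hx.2 t, Prod.norm_def]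
  refine max_lt ?_ ?_
  · simpa using (hH.norm_dp_le hl hε x.1 hx.2 t).trans_lt ht2
  · simpa using (hH.norm_dq_le hl hε x.1 hx.2 t).trans_lt ht1

end Perturbed

section AsymptoticVectorFields

variable {n : ℕ} {σ Υ l ε : ℝ} {h : E n → ℝ} {f : E n → E n → ℝ → ℝ}

theorem IsPerturbed.lipDeriv_freq (hH : IsPerturbed σ Υ l ε h f) (hl : 1 < l) (hε : 0 < ε)
    {M : ℝ} (hM : ∀ t : ℝ, BddDeriv (⌊σ⌋₊ + 1) M (phase (ball 0 1))
      (fun x : E n × E n => XH (ham h f) x.1 x.2 t)) :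
    LipDeriv ⌊σ⌋₊ M (phase (ball 0 1)) (fun x : E n × E n => ((freq h x.2, 0) : E n × E n)) :=
  (lipDeriv_of_tendstoUniformlyOn ⌊σ⌋₊ (fun t => (hM t).lipDeriv isOpen_phase convex_phase)
    (hH.tendstoUniformlyOn hl hε tendsto_abs_atTop_atTop)).1

theorem IsPerturbed.tendsto_holderNormOn (hH : IsPerturbed σ Υ l ε h f) (hσ : 1 ≤ σ) (hl : 1 < l)
    (hε : 0 < ε) {M : ℝ} (hM0 : 0 ≤ M) (hM : ∀ t : ℝ, BddDeriv (⌊σ⌋₊ + 1) M (phase (ball 0 1))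
      (fun x : E n × E n => XH (ham h f) x.1 x.2 t)) {F : Filter ℝ} [F.NeBot]
    (hF : Tendsto (fun t : ℝ => |t|) F atTop) :
    Tendsto (fun t : ℝ => holderNormOn e2 σ (phase (ball 0 1))
      fun x : E n × E n => XH (ham h f) x.1 x.2 t - XH (integrable h) x.1 x.2 t) F (𝓝 0) := by
  have hU := isOpen_phase (n := n)
  have hX : ∀ t, LipDeriv ⌊σ⌋₊ M (phase (ball 0 1))
      (fun x : E n × E n => XH (ham h f) x.1 x.2 t) :=
    fun t => (hM t).lipDeriv isOpen_phase convex_phase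
  obtain ⟨hX₀, hlim⟩ := lipDeriv_of_tendstoUniformlyOn ⌊σ⌋₊ hX (hH.tendstoUniformlyOn hl hε hF)
  simp only [XH_integrable]
  have hsub : ∀ t : ℝ, ∀ j ≤ ⌊σ⌋₊, ∀ x ∈ phase (ball (0 : E n) 1),
      iteratedFDerivWithin ℝ j
        (fun x : E n × E n => XH (ham h f) x.1 x.2 t - (freq h x.2, 0)) (phase (ball 0 1)) x
      = iteratedFDerivWithin ℝ j (fun x : E n × E n => XH (ham h f) x.1 x.2 t)
          (phase (ball 0 1)) x
        - iteratedFDerivWithin ℝ j (fun x : E n × E n => ((freq h x.2, 0) : E n × E n))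
          (phase (ball 0 1)) x := by
    intro t j hj x hx
    have hj' : (j : WithTop ℕ∞) ≤ ⌊σ⌋₊ := by exact_mod_cast hj
    exact iteratedFDerivWithin_sub_apply (((hX t).1.1 x hx).of_le hj')
      ((hX₀.1.1 x hx).of_le hj') hU.uniqueDiffOn hx
  refine Biasymptotic.tendsto_holderNormOn (M := 2 * M) (by linarith) norm_e2 (by positivity)
    (fun j hj η hη => ?_) (fun t x hx y hy => ?_)
  · filter_upwards [Metric.tendstoUniformlyOn_iff.1 (hlim j hj) η hη] with t ht x hx
    rw [hsub t j hj x hx, ← dist_eq_norm, dist_comm]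
    exact (ht x hx).le
  · rw [hsub t _ le_rfl x hx, hsub t _ le_rfl y hy, sub_sub_sub_comm]
    refine (norm_sub_le _ _).trans ?_
    linarith [(hX t).2 x hx y hy, hX₀.2 x hx y hy]

theorem fderiv_trivEmb (p q : E n) :
    fderiv ℝ (trivEmb p) q = ContinuousLinearMap.inl ℝ (E n) (E n) :=
  (hasFDerivAt_prodMk_left q p).fderiv

theorem isTorusEmbedding_trivEmb (hσ : 1 ≤ σ) {p : E n} (hp : p ∈ ball (0 : E n) 1) :
    IsTorusEmbedding σ (ball 0 1) (trivEmb p) where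
  mem _ := hp
  lift := by
    refine ⟨ContinuousLinearMap.id ℝ (E n), fun k => ⟨k, rfl⟩, fun q k => by simp [trivEmb], ?_⟩
    have e1 : (fun q : E n => trivEmb p q - (ContinuousLinearMap.id ℝ (E n) q, 0))
        = fun _ => ((0, p) : E n × E n) := by
      funext q
      simp [trivEmb]
    rw [e1]
    refine LipDeriv.holderOn (M := ‖((0, p) : E n × E n)‖) (by linarith)
      (fun i => (norm_e i).le) (norm_nonneg _) ?_
    exact (bddDeriv_const (norm_nonneg _) _ le_rfl).lipDeriv isOpen_univ convex_univ
  inj q q' k h1 _ := ⟨k, h1⟩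
  immersion q := by
    rw [fderiv_trivEmb]
    intro a b hab
    simpa using hab

theorem IsPerturbed.asymptoticData (hH : IsPerturbed σ Υ l ε h f) (hσ : 1 ≤ σ) (hl : 1 < l)
    (hε : 0 < ε) (hΥ : 1 ≤ Υ) {K : ℝ} (hK : freqNorm h ≤ ENNReal.ofReal K) {pp pm : E n}
    (hpp : pp ∈ ball (0 : E n) 1) (hpm : pm ∈ ball (0 : E n) 1) :
    AsymptoticData σ 0 (ball 0 1) (XH (ham h f)) (XH (integrable h)) (XH (integrable h))
      (trivEmb pp) (trivEmb pm) (freq h pp) (freq h pm) := by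
  obtain ⟨M, hM0, hM⟩ := hH.bddDeriv_XH hσ hε hΥ hK
  have hσ0 : 0 ≤ σ := by linarith
  have hint : IsVectorField σ (ball 0 1) (XH (integrable h)) := by
    refine ⟨fun q p _ t k => ?_, fun t => ?_⟩
    · rw [XH_integrable, XH_integrable]
    · simp only [XH_integrable]
      exact (hH.lipDeriv_freq hl hε hM).holderOn hσ0 norm_e2 hM0
  have hham : IsVectorField σ (ball 0 1) (XH (ham h f)) := by
    refine ⟨fun q p hp t k => ?_, fun t => ?_⟩
    · rw [hH.XH_ham _ hp, hH.XH_ham _ hp]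
      simp only [(hH.memB_dp _).per q p hp t k, (hH.memB_dq _).per q p hp t k]
    · exact ((hM t).lipDeriv isOpen_phase convex_phase).holderOn hσ0 norm_e2 hM0
  have e0 : σ + ((0 : ℕ) : ℝ) = σ := by simp
  constructor
  · rwa [e0]
  · rwa [e0]
  · rwa [e0]
  · exact isTorusEmbedding_trivEmb hσ hpp
  · exact isTorusEmbedding_trivEmb hσ hpm
  · rw [e0]
    exact hH.tendsto_holderNormOn hσ hl hε hM0 hM tendsto_abs_atTop_atTop
  · rw [e0]
    exact hH.tendsto_holderNormOn hσ hl hε hM0 hM tendsto_abs_atBot_atTop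
  · intro q t
    rw [XH_integrable, fderiv_trivEmb]
    simp [trivEmb]
  · intro q t
    rw [XH_integrable, fderiv_trivEmb]
    simp [trivEmb]

theorem continuousOn_extPhase_toLp {g : Fin n → E n → E n → ℝ → ℝ} {A : Set (E n)}
    (hg : ∀ i, ContinuousOn (fun x : E n × E n × ℝ => g i x.1 x.2.1 x.2.2) (extPhase A)) :
    ContinuousOn (fun x : E n × E n × ℝ => (WithLp.toLp 2 fun i => g i x.1 x.2.1 x.2.2 : E n))
      (extPhase A) :=
  (PiLp.continuous_toLp 2 _).comp_continuousOn (continuousOn_pi.2 hg)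

theorem IsPerturbed.continuousOn_freq (hH : IsPerturbed σ Υ l ε h f) :
    ContinuousOn (freq h) (ball 0 1) :=
  (PiLp.continuous_toLp 2 _).comp_continuousOn (continuousOn_pi.2 fun _ =>
    hH.contDiffOn_fderiv_h.continuousOn.clm_apply continuousOn_const)

theorem IsPerturbed.isHamiltonian (hH : IsPerturbed σ Υ l ε h f) :
    IsHamiltonian (ball 0 1) (integrable h) := by
  have hmaps : MapsTo (fun x : E n × E n × ℝ => x.2.1) (extPhase (ball 0 1)) (ball 0 1) :=
    fun x hx => hx.2.1
  constructor
  · intro q p _ t k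
    rfl
  · exact hH.h_smooth.continuousOn.comp (by fun_prop) hmaps
  · intro t
    exact (hH.h_smooth.of_le (by norm_num)).comp contDiffOn_snd fun x hx => hx.2
  · simp only [XH_integrable]
    exact (hH.continuousOn_freq.comp (by fun_prop) hmaps).prodMk continuousOn_const

theorem IsPerturbed.continuous_XH (hH : IsPerturbed σ Υ l ε h f) (q : E n) {p : E n}
    (hp : p ∈ ball (0 : E n) 1) : Continuous fun t => XH (ham h f) q p t := by
  simp only [hH.XH_ham q hp]
  have hc : Continuous fun t : ℝ => ((q, p, t) : E n × E n × ℝ) := by fun_prop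
  have hm : ∀ t : ℝ, ((q, p, t) : E n × E n × ℝ) ∈ extPhase (ball (0 : E n) 1) :=
    fun t => ⟨mem_univ _, hp, mem_univ _⟩
  refine (continuous_const.add ?_).prodMk ?_
  · exact (continuousOn_extPhase_toLp hH.memB_f.cont_dp).comp_continuous hc hm
  · exact (continuousOn_extPhase_toLp (g := fun i q p t => -dq i f q p t)
      fun i => (hH.memB_dq i).cont.neg).comp_continuous hc hm

end AsymptoticVectorFields

section GlobalSolutions

variable {X : Type*} [NormedAddCommGroup X] [NormedSpace ℝ X]

/-- A bounded, globally Lipschitz vector field has global solutions. -/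
theorem exists_global_solution [CompleteSpace X] {v : ℝ → X → X} {K L : NNReal}
    (hlip : ∀ t, LipschitzWith K (v t)) (hc : ∀ x, Continuous fun t => v t x)
    (hb : ∀ t x, ‖v t x‖ ≤ L) (x₀ : X) :
    ∃ g : ℝ → X, g 0 = x₀ ∧ ∀ t, HasDerivAt g (v t (g t)) t := by
  have hloc : ∀ N : ℕ, ∃ g : ℝ → X, g 0 = x₀ ∧
      ∀ t ∈ Ioo (-(N + 1 : ℝ)) (N + 1), HasDerivAt g (v t (g t)) t := by
    intro N
    have hN : (0 : ℝ) < N + 1 := by positivity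
    have hPL : IsPicardLindelof v (tmin := -(N + 1 : ℝ)) (tmax := N + 1)
        ⟨0, by linarith, hN.le⟩ x₀ (L * (N + 1)) 0 L K := by
      refine ⟨fun t _ => (hlip t).lipschitzOnWith, fun x _ => (hc x).continuousOn,
        fun t _ x _ => hb t x, ?_⟩
      simp
    obtain ⟨g, hg0, hg⟩ := hPL.exists_eq_forall_mem_Icc_hasDerivWithinAt₀
    exact ⟨g, hg0, fun t ht => (hg t (Ioo_subset_Icc_self ht)).hasDerivAt
      (Icc_mem_nhds ht.1 ht.2)⟩
  choose G hG0 hG using hloc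
  have hagree : ∀ M N : ℕ, M ≤ N → ∀ t ∈ Ioo (-(M + 1 : ℝ)) (M + 1), G M t = G N t := by
    intro M N hMN
    have hMN' : (M : ℝ) ≤ N := by exact_mod_cast hMN
    refine ODE_solution_unique_of_mem_Ioo (s := fun _ => univ) (K := K) (t₀ := 0) (v := v)
      (fun t _ => (hlip t).lipschitzOnWith) ⟨by linarith [Nat.cast_nonneg (α := ℝ) M],
        by linarith [Nat.cast_nonneg (α := ℝ) M]⟩
      (fun t ht => ⟨hG M t ht, mem_univ _⟩)
      (fun t ht => ⟨hG N t ⟨by linarith [ht.1], by linarith [ht.2]⟩, mem_univ _⟩) ?_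
    rw [hG0, hG0]
  have hmem : ∀ t : ℝ, t ∈ Ioo (-(⌈|t|⌉₊ + 1 : ℝ)) (⌈|t|⌉₊ + 1) := fun t => by
    have := Nat.le_ceil |t|
    constructor <;> linarith [neg_abs_le t, le_abs_self t]
  have key : ∀ N : ℕ, ∀ t ∈ Ioo (-(N + 1 : ℝ)) (N + 1), G ⌈|t|⌉₊ t = G N t := by
    intro N t ht
    rcases le_total ⌈|t|⌉₊ N with hle | hle
    · exact hagree _ _ hle t (hmem t)
    · exact (hagree _ _ hle t ht).symm
  refine ⟨fun t => G ⌈|t|⌉₊ t, hG0 _, fun t => ?_⟩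
  refine (hG ⌈|t|⌉₊ t (hmem t)).congr_of_eventuallyEq ?_
  filter_upwards [isOpen_Ioo.mem_nhds (hmem t)] with s hs using key _ s hs

/-- The radial retraction onto the closed ball of radius `R`. -/
def retract (R : ℝ) (x : X) : X := (max 1 (‖x‖ / R))⁻¹ • x

theorem retract_of_norm_le {R : ℝ} (hR : 0 < R) {x : X} (hx : ‖x‖ ≤ R) : retract R x = x := by
  have : ‖x‖ / R ≤ 1 := (div_le_one hR).2 hx
  rw [retract, max_eq_left this, inv_one, one_smul]

theorem norm_retract_le {R : ℝ} (hR : 0 < R) (x : X) : ‖retract R x‖ ≤ R := by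
  have h1 : 0 < max 1 (‖x‖ / R) := zero_lt_one.trans_le (le_max_left _ _)
  rw [retract, norm_smul, Real.norm_of_nonneg (inv_nonneg.2 h1.le), inv_mul_le_iff₀ h1]
  have := (div_le_iff₀ hR).1 (le_max_right 1 (‖x‖ / R))
  exact this

theorem norm_retract_sub_le {R : ℝ} (hR : 0 < R) (x y : X) :
    ‖retract R x - retract R y‖ ≤ 2 * ‖x - y‖ := by
  set a := max 1 (‖x‖ / R) with ha
  set b := max 1 (‖y‖ / R) with hb
  have ha1 : 1 ≤ a := le_max_left _ _
  have hb1 : 1 ≤ b := le_max_left _ _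
  have hyb : ‖y‖ ≤ b * R := (div_le_iff₀ hR).1 (le_max_right 1 (‖y‖ / R))
  have hab : |b - a| ≤ ‖x - y‖ / R := by
    rw [ha, hb, max_comm 1, max_comm 1]
    refine (abs_max_sub_max_le_abs (‖y‖ / R) (‖x‖ / R) 1).trans ?_
    rw [← sub_div, abs_div, abs_of_pos hR, norm_sub_rev]
    gcongr
    exact abs_norm_sub_norm_le y x
  have e : retract R x - retract R y = a⁻¹ • (x - y) + (a⁻¹ - b⁻¹) • y := by
    rw [retract, retract, smul_sub, sub_smul]
    abel
  rw [e]
  have h1 : ‖a⁻¹ • (x - y)‖ ≤ ‖x - y‖ := by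
    rw [norm_smul, Real.norm_of_nonneg (by positivity)]
    exact mul_le_of_le_one_left (norm_nonneg _) (inv_le_one_of_one_le₀ ha1)
  have h2 : ‖(a⁻¹ - b⁻¹) • y‖ ≤ ‖x - y‖ := by
    have e2 : a⁻¹ - b⁻¹ = (b - a) / (a * b) := by field_simp
    rw [norm_smul, e2, Real.norm_eq_abs, abs_div, abs_of_pos (by positivity : 0 < a * b),
      div_mul_eq_mul_div, div_le_iff₀ (by positivity)]
    calc |b - a| * ‖y‖ ≤ ‖x - y‖ / R * (b * R) := by gcongr
      _ = ‖x - y‖ * (1 * b) := by field_simp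
      _ ≤ ‖x - y‖ * (a * b) := by gcongr
  linarith [norm_add_le (a⁻¹ • (x - y)) ((a⁻¹ - b⁻¹) • y)]

end GlobalSolutions

section Decay

variable {X : Type*} [NormedAddCommGroup X] [NormedSpace ℝ X]

theorem norm_sub_le_of_deriv_le {y y' : ℝ → X} {B B' : ℝ → ℝ} {a b : ℝ} (hab : a ≤ b)
    (hy : ∀ t, HasDerivAt y (y' t) t) (hB : ∀ t ∈ Icc a b, HasDerivAt B (B' t) t)
    (hle : ∀ t ∈ Icc a b, ‖y' t‖ ≤ B' t) : ‖y b - y a‖ ≤ B b - B a :=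
  image_norm_le_of_norm_deriv_right_le_deriv_boundary' (f := fun t => y t - y a) (f' := y')
    (B := fun t => B t - B a) (B' := B')
    (fun t _ => ((hy t).sub_const _).continuousAt.continuousWithinAt)
    (fun t _ => ((hy t).sub_const _).hasDerivWithinAt) (by simp)
    (fun t ht => ((hB t ht).sub_const _).continuousAt.continuousWithinAt)
    (fun t ht => ((hB t (Ico_subset_Icc_self ht)).sub_const _).hasDerivWithinAt)
    (fun t ht => hle t (Ico_subset_Icc_self ht)) (right_mem_Icc.2 hab)

theorem norm_sub_zero_le_of_deriv_le {y y' : ℝ → X} {c t : ℝ} (hc : 0 ≤ c) (ht : 0 ≤ t)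
    (hy : ∀ t, HasDerivAt y (y' t) t) (hle : ∀ t, 0 ≤ t → ‖y' t‖ ≤ c / (1 + t ^ 2)) :
    ‖y t - y 0‖ ≤ 2 * c := by
  have h1 := norm_sub_le_of_deriv_le (B := fun t => c * Real.arctan t)
    (B' := fun t => c * (1 / (1 + t ^ 2))) ht hy
    (fun s _ => (Real.hasDerivAt_arctan s).const_mul c)
    (fun s hs => by simpa [div_eq_mul_inv] using hle s hs.1)
  have h2 : c * Real.arctan t ≤ c * 2 := by
    gcongr
    linarith [Real.arctan_lt_pi_div_two t, Real.pi_lt_four]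
  simp only [Real.arctan_zero] at h1
  linarith

theorem exists_limit_of_deriv_le [CompleteSpace X] {y y' : ℝ → X} {c : ℝ} {k : ℕ} (hk : k ≠ 0)
    (hy : ∀ t, HasDerivAt y (y' t) t) (hc : 0 ≤ c)
    (hle : ∀ t, 1 ≤ t → ‖y' t‖ ≤ c / t ^ (k + 1)) :
    ∃ z, Tendsto y atTop (𝓝 z) ∧ ∀ t, 1 ≤ t → ‖y t - z‖ ≤ c / t ^ k := by
  have hk1 : (1 : ℝ) ≤ k := by exact_mod_cast Nat.one_le_iff_ne_zero.2 hk
  have hdiff : ∀ s t, 1 ≤ s → s ≤ t → ‖y t - y s‖ ≤ c / s ^ k := by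
    intro s t hs hst
    have h1 := norm_sub_le_of_deriv_le (y := y) (B := fun t => -(c / k) * (t ^ k)⁻¹)
      (B' := fun t => c / t ^ (k + 1)) hst hy
      (fun r hr => by
        have hr0 : r ≠ 0 := by linarith [hr.1]
        have h2 := (((hasDerivAt_pow k r).inv (pow_ne_zero k hr0)).const_mul (-(c / k)))
        refine h2.congr_deriv ?_
        obtain ⟨j, rfl⟩ := Nat.exists_eq_succ_of_ne_zero hk
        have : ((j : ℝ) + 1) ≠ 0 := by positivity
        simp only [Nat.succ_eq_add_one, Nat.add_sub_cancel]
        push_cast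
        field_simp
        ring)
      (fun r hr => hle r (hs.trans hr.1))
    refine h1.trans ?_
    have h3 : 0 ≤ (c / k) * (t ^ k)⁻¹ := by
      have : 0 ≤ t := by linarith
      positivity
    have h4 : (c / k) * (s ^ k)⁻¹ ≤ c / s ^ k := by
      have : 0 < s := by linarith
      rw [div_eq_mul_inv c (s ^ k)]
      gcongr
      exact div_le_self hc hk1
    linarith
  have hlim : Tendsto (fun t : ℝ => c / t ^ k) atTop (𝓝 0) :=
    tendsto_const_nhds.div_atTop (tendsto_pow_atTop hk)
  have hcau : CauchySeq y := by
    rw [Metric.cauchySeq_iff']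
    intro η hη
    obtain ⟨N, hN, hN1⟩ := ((hlim.eventually (gt_mem_nhds hη)).and (eventually_ge_atTop 1)).exists
    refine ⟨N, fun t ht => ?_⟩
    rw [dist_eq_norm]
    exact (hdiff N t hN1 ht).trans_lt hN
  obtain ⟨z, hz⟩ := cauchySeq_tendsto_of_complete hcau
  refine ⟨z, hz, fun t ht => ?_⟩
  rw [norm_sub_rev]
  refine le_of_tendsto (hz.sub_const (y t)).norm ?_
  filter_upwards [eventually_ge_atTop t] with s hs using hdiff t s ht hs

theorem weight_le_div_pow {c a t : ℝ} (hc : 0 ≤ c) {k : ℕ} (hk : (k : ℝ) ≤ a) (ht : 1 ≤ t) :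
    c / (1 + |t| ^ a) ≤ c / t ^ k := by
  have ht0 : 0 < t := by linarith
  gcongr
  rw [abs_of_pos ht0, ← Real.rpow_natCast]
  linarith [Real.rpow_le_rpow_of_exponent_le ht hk]

theorem weight_le_div_one_add_sq {c a t : ℝ} (hc : 0 ≤ c) (ha : 2 ≤ a) :
    c / (1 + |t| ^ a) ≤ 2 * c / (1 + t ^ 2) := by
  have h0 : 0 ≤ |t| ^ a := Real.rpow_nonneg (abs_nonneg t) a
  have h1 : 1 + t ^ 2 ≤ 2 * (1 + |t| ^ a) := by
    rw [← sq_abs t]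
    rcases le_total |t| 1 with h | h
    · nlinarith [abs_nonneg t]
    · have := Real.rpow_le_rpow_of_exponent_le h ha
      rw [Real.rpow_two] at this
      nlinarith
  rw [div_le_div_iff₀ (by positivity) (by positivity)]
  nlinarith

end Decay

section Scattering

variable {n : ℕ} {l c M : ℝ}

/-- A curve with `q' = Ω(p) + r` and `p' = s`, where `r` and `s` decay, is asymptotic to a linear
motion. -/
theorem exists_asymptotic_motion {Ω : E n → E n} {q p r s : ℝ → E n} (hl : 1 < l) (hc : 0 ≤ c)
    (hM : 0 ≤ M) (hq : ∀ t, HasDerivAt q (Ω (p t) + r t) t) (hp : ∀ t, HasDerivAt p (s t) t)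
    (hr : ∀ t, ‖r t‖ ≤ c / (1 + |t| ^ (l + 1))) (hs : ∀ t, ‖s t‖ ≤ c / (1 + |t| ^ (l + 2)))
    {R : ℝ} (hR : R < 1) (hpR : ∀ t, ‖p t‖ ≤ R)
    (hΩ : ∀ x ∈ ball (0 : E n) 1, ∀ y ∈ ball (0 : E n) 1, ‖Ω x - Ω y‖ ≤ M * ‖x - y‖) :
    ∃ p₀ ∈ ball (0 : E n) 1, Tendsto p atTop (𝓝 p₀) ∧
      ∃ q₀, Tendsto (fun t => q t - (q₀ + t • Ω p₀)) atTop (𝓝 0) := by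
  obtain ⟨p₀, hp₀, hpd⟩ := exists_limit_of_deriv_le (k := 2) two_ne_zero hp hc fun t ht =>
    (hs t).trans (weight_le_div_pow hc (by push_cast; linarith) ht)
  have hp₀R : ‖p₀‖ ≤ R := le_of_tendsto hp₀.norm (Eventually.of_forall hpR)
  have hp₀b : p₀ ∈ ball (0 : E n) 1 := mem_ball_zero_iff.2 (hp₀R.trans_lt hR)
  refine ⟨p₀, hp₀b, hp₀, ?_⟩
  have hz : ∀ t, HasDerivAt (fun t => q t - t • Ω p₀) (Ω (p t) + r t - Ω p₀) t := fun t => by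
    have := (hq t).fun_sub ((hasDerivAt_id t).smul_const (Ω p₀))
    simpa using this
  obtain ⟨q₀, hq₀, -⟩ := exists_limit_of_deriv_le (k := 1) (c := (M + 1) * c) one_ne_zero hz
    (by positivity) fun t ht => by
      have h1 := hΩ (p t) (mem_ball_zero_iff.2 ((hpR t).trans_lt hR)) p₀ hp₀b
      have h2 : M * ‖p t - p₀‖ ≤ M * (c / t ^ 2) := by gcongr; exact hpd t ht
      have h3 := (hr t).trans (weight_le_div_pow (k := 2) hc (by push_cast; linarith) ht)
      have e : Ω (p t) + r t - Ω p₀ = (Ω (p t) - Ω p₀) + r t := by abel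
      rw [e]
      refine (norm_add_le _ _).trans ?_
      have e2 : (M + 1) * c / t ^ (1 + 1) = M * (c / t ^ 2) + c / t ^ 2 := by ring
      rw [e2]
      linarith
  refine ⟨q₀, ?_⟩
  have := hq₀.sub_const q₀
  simp only [sub_self] at this
  refine this.congr fun t => ?_
  abel

theorem distT_nonneg (x y : E n) : 0 ≤ distT x y := Real.iInf_nonneg fun _ => norm_nonneg _

theorem distT_le (x y : E n) : distT x y ≤ ‖x - y‖ := by
  refine (ciInf_le ⟨0, ?_⟩ (0 : Fin n → ℤ)).trans (le_of_eq ?_)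
  · rintro _ ⟨k, rfl⟩
    exact norm_nonneg _
  · have : latt (0 : Fin n → ℤ) = 0 := by
      ext i
      simp [latt]
    rw [this, sub_zero]

theorem tendsto_distPhase {F : Filter ℝ} {g : ℝ → E n × E n} {a : ℝ → E n} {p : E n}
    (h1 : Tendsto (fun t => (g t).1 - a t) F (𝓝 0)) (h2 : Tendsto (fun t => (g t).2) F (𝓝 p)) :
    Tendsto (fun t => distPhase (g t) (trivEmb p (a t))) F (𝓝 0) := by
  have h3 : Tendsto (fun t => ‖(g t).1 - a t‖ + ‖(g t).2 - p‖) F (𝓝 0) := by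
    have := h1.norm.add (h2.sub_const p).norm
    simpa using this
  refine squeeze_zero (fun t => ?_) (fun t => ?_) h3
  · exact add_nonneg (distT_nonneg _ _) (norm_nonneg _)
  · exact add_le_add (distT_le _ _) le_rfl

variable {σ Υ ε : ℝ} {h : E n → ℝ} {f : E n → E n → ℝ → ℝ}

/-- The solutions of `X_H` that start in `𝕋ⁿ × B_{1/2}` are global and stay in `𝕋ⁿ × B_{3/4}`. -/
theorem IsPerturbed.exists_solution (hH : IsPerturbed σ Υ l ε h f) (hl : 1 < l) (hε : 0 < ε)
    (hM0 : 0 ≤ M) (hM : ∀ t : ℝ, BddDeriv (⌊σ⌋₊ + 1) M (phase (ball 0 1))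
      (fun x : E n × E n => XH (ham h f) x.1 x.2 t)) (hsmall : 16 * (n * ε) ≤ 1)
    (q : E n) {p : E n} (hp : p ∈ ball (0 : E n) (1 / 2)) :
    ∃ g : ℝ → E n × E n, g 0 = (q, p) ∧ (∀ t, ‖(g t).2‖ ≤ 3 / 4) ∧
      ∀ t, HasDerivAt g (XH (ham h f) (g t).1 (g t).2 t) t := by
  have hR : (0 : ℝ) < 3 / 4 := by norm_num
  have hret : ∀ x : E n, retract (3 / 4) x ∈ ball (0 : E n) 1 := fun x =>
    mem_ball_zero_iff.2 ((norm_retract_le hR x).trans_lt (by norm_num))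
  set v : ℝ → E n × E n → E n × E n := fun t x => XH (ham h f) x.1 (retract (3 / 4) x.2) t with hv
  have hmem : ∀ x : E n × E n, (x.1, retract (3 / 4) x.2) ∈ phase (ball (0 : E n) 1) :=
    fun x => ⟨mem_univ _, hret _⟩
  have hlip : ∀ t, LipschitzWith (M * 2).toNNReal (v t) := fun t => by
    refine LipschitzWith.of_dist_le_mul fun x y => ?_
    rw [Real.coe_toNNReal _ (by positivity), dist_eq_norm, dist_eq_norm]
    refine ((hM t).norm_sub_le isOpen_phase convex_phase (hmem x) (hmem y)).trans ?_
    rw [mul_assoc]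
    gcongr
    rw [Prod.norm_def]
    refine max_le ?_ ?_
    · have := norm_fst_le (x - y)
      rw [Prod.fst_sub] at this
      simp only [Prod.fst_sub]
      linarith [norm_nonneg (x - y)]
    · have := norm_snd_le (x - y)
      rw [Prod.snd_sub] at this
      simp only [Prod.snd_sub]
      linarith [norm_retract_sub_le hR x.2 y.2]
  have hvc : ∀ x, Continuous fun t => v t x := fun x => hH.continuous_XH x.1 (hret x.2)
  have hvb : ∀ t x, ‖v t x‖ ≤ M.toNNReal := fun t x => by
    have h1 := (hM t).norm_le (hmem x)
    rwa [Real.coe_toNNReal _ hM0]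
  obtain ⟨g, hg0, hg⟩ := exists_global_solution hlip hvc hvb (q, p)
  have hp' : ∀ t, HasDerivAt (fun t => (g t).2) (v t (g t)).2 t := fun t =>
    ((ContinuousLinearMap.snd ℝ (E n) (E n)).hasFDerivAt.comp_hasDerivAt t (hg t))
  have hnε : 0 ≤ n * ε := by positivity
  have hpb : ∀ t, ‖(v t (g t)).2‖ ≤ 2 * (n * ε) / (1 + t ^ 2) := fun t => by
    rw [hv]
    simp only [hH.XH_ham _ (hret _) t]
    refine (hH.norm_dq_le hl hε _ (hret _) t).trans ?_
    rw [← mul_div_assoc]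
    exact weight_le_div_one_add_sq hnε (by linarith)
  have hdisp : ∀ t, ‖(g t).2 - p‖ ≤ 1 / 4 := by
    have hg02 : (g 0).2 = p := by rw [hg0]
    intro t
    rcases le_total 0 t with ht | ht
    · have := norm_sub_zero_le_of_deriv_le (c := 2 * (n * ε)) (by positivity) ht hp'
        fun t _ => hpb t
      rw [hg02] at this
      linarith
    · have := norm_sub_zero_le_of_deriv_le (y := fun s => (g (-s)).2)
        (y' := fun s => -(v (-s) (g (-s))).2) (c := 2 * (n * ε)) (t := -t) (by positivity)
        (by linarith) (fun s => by
          have h1 := (hp' (-s)).scomp s (hasDerivAt_neg s)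
          simpa [Function.comp_def] using h1)
        fun s _ => by simpa using hpb (-s)
      simp only [neg_neg, neg_zero, hg02] at this
      linarith
  have h34 : ∀ t, ‖(g t).2‖ ≤ 3 / 4 := fun t => by
    have h1 := norm_add_le ((g t).2 - p) p
    rw [sub_add_cancel] at h1
    linarith [hdisp t, mem_ball_zero_iff.1 hp]
  refine ⟨g, hg0, h34, fun t => ?_⟩
  have h1 := hg t
  rw [hv] at h1
  simp only [retract_of_norm_le hR (h34 t)] at h1
  exact h1

/-- Every solution that stays in `𝕋ⁿ × B_{3/4}` is asymptotic to quasiperiodic motions. -/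
theorem IsPerturbed.exists_asymptotic (hH : IsPerturbed σ Υ l ε h f) (hl : 1 < l) (hε : 0 < ε)
    (hM0 : 0 ≤ M)
    (hΩ : ∀ x ∈ ball (0 : E n) 1, ∀ y ∈ ball (0 : E n) 1, ‖freq h x - freq h y‖ ≤ M * ‖x - y‖)
    {g : ℝ → E n × E n} (hgR : ∀ t, ‖(g t).2‖ ≤ 3 / 4)
    (hg : ∀ t, HasDerivAt g (XH (ham h f) (g t).1 (g t).2 t) t) :
    (∃ pp ∈ ball (0 : E n) 1, ∃ qp : E n, Tendsto
      (fun t : ℝ => distPhase (g t) (trivEmb pp (qp + t • freq h pp))) atTop (𝓝 0)) ∧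
    ∃ pm ∈ ball (0 : E n) 1, ∃ qm : E n, Tendsto
      (fun t : ℝ => distPhase (g t) (trivEmb pm (qm + t • freq h pm))) atBot (𝓝 0) := by
  have hb : ∀ t, (g t).2 ∈ ball (0 : E n) 1 := fun t =>
    mem_ball_zero_iff.2 ((hgR t).trans_lt (by norm_num))
  set r : ℝ → E n := fun t => WithLp.toLp 2 fun i => dp i f (g t).1 (g t).2 t with hr
  set s : ℝ → E n := fun t => WithLp.toLp 2 fun i => -dq i f (g t).1 (g t).2 t with hs
  have hX : ∀ t, XH (ham h f) (g t).1 (g t).2 t = (freq h (g t).2 + r t, s t) := fun t =>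
    hH.XH_ham _ (hb t) t
  have hq' : ∀ t, HasDerivAt (fun t => (g t).1) (freq h (g t).2 + r t) t := fun t => by
    have := (ContinuousLinearMap.fst ℝ (E n) (E n)).hasFDerivAt.comp_hasDerivAt t (hg t)
    rw [hX] at this
    exact this
  have hp' : ∀ t, HasDerivAt (fun t => (g t).2) (s t) t := fun t => by
    have := (ContinuousLinearMap.snd ℝ (E n) (E n)).hasFDerivAt.comp_hasDerivAt t (hg t)
    rw [hX] at this
    exact this
  have hnε : 0 ≤ n * ε := by positivity
  have hrb : ∀ t, ‖r t‖ ≤ n * ε / (1 + |t| ^ (l + 1)) := fun t => by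
    rw [mul_div_assoc]
    exact hH.norm_dp_le hl hε _ (hb t) t
  have hsb : ∀ t, ‖s t‖ ≤ n * ε / (1 + |t| ^ (l + 2)) := fun t => by
    rw [mul_div_assoc]
    exact hH.norm_dq_le hl hε _ (hb t) t
  constructor
  · obtain ⟨pp, hpp, hlim, qp, hqp⟩ := exists_asymptotic_motion hl hnε hM0 hq' hp' hrb hsb
      (by norm_num) hgR hΩ
    exact ⟨pp, hpp, qp, tendsto_distPhase hqp hlim⟩
  · obtain ⟨pm, hpm, hlim, qm, hqm⟩ := exists_asymptotic_motion (Ω := fun x => -freq h x)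
      (q := fun t => (g (-t)).1) (p := fun t => (g (-t)).2) (r := fun t => -r (-t))
      (s := fun t => -s (-t)) hl hnε hM0
      (fun t => by
        have := (hq' (-t)).scomp t (hasDerivAt_neg t)
        simpa [Function.comp_def, add_comm] using this)
      (fun t => by
        have := (hp' (-t)).scomp t (hasDerivAt_neg t)
        simpa [Function.comp_def] using this)
      (fun t => by simpa using hrb (-t)) (fun t => by simpa using hsb (-t))
      (by norm_num) (fun t => hgR (-t))
      (fun x hx y hy => by
        rw [neg_sub_neg, norm_sub_rev]
        exact hΩ x hx y hy)
    refine ⟨pm, hpm, qm, tendsto_distPhase ?_ ?_⟩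
    · have := hqm.comp tendsto_neg_atBot_atTop
      simpa [Function.comp_def] using this
    · have := hlim.comp tendsto_neg_atBot_atTop
      simpa [Function.comp_def] using this

end Scattering

end Biasymptotic

end

/-- The threshold `ε₀` depends only on `n`, `l`, `Υ` and (a bound `K` of) `|∂_p h|_{C¹}`. -/
theorem biasymptotic_integrable (n : ℕ) (l Υ K : ℝ) (hl : 1 < l) (hΥ : 1 ≤ Υ) :
    ∃ ε₀ : ℝ, 0 < ε₀ ∧
      ∀ (σ ε : ℝ) (h : E n → ℝ) (f : E n → E n → ℝ → ℝ),
        1 ≤ σ → 0 < ε → ε < 1 →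
        IsPerturbed σ Υ l ε h f →
        freqNorm h ≤ ENNReal.ofReal K →
        ∃ ht : E n → E n → ℝ → ℝ, IsHamiltonian (ball 0 1) ht ∧
          (ε ≤ ε₀ →
            ∀ q : E n, ∀ p ∈ ball (0 : E n) (1 / 2),
              ∃ pm ∈ ball (0 : E n) 1, ∃ pp ∈ ball (0 : E n) 1,
                ∃ (ωp ωm : E n) (g : ℝ → E n × E n),
                  IsBiasymptotic σ 0 (ball 0 1) (XH (ham h f)) (XH ht) (XH ht)
                    (trivEmb pp) (trivEmb pm) ωp ωm g ∧
                  g 0 = (q, p)) := by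
  refine ⟨1 / (16 * (n + 1)), by positivity, fun σ ε h f hσ hε _ hH hK =>
    ⟨integrable h, hH.isHamiltonian, fun hε₀ q p hp => ?_⟩⟩
  obtain ⟨M, hM0, hM⟩ := hH.bddDeriv_XH hσ hε hΥ hK
  have hsmall : 16 * (n * ε) ≤ 1 := by
    rw [le_div_iff₀ (by positivity)] at hε₀
    nlinarith
  obtain ⟨g, hg0, hgR, hg⟩ := hH.exists_solution hl hε hM0 hM hsmall q hp
  have hΩ : ∀ x ∈ ball (0 : E n) 1, ∀ y ∈ ball (0 : E n) 1,
      ‖freq h x - freq h y‖ ≤ M * ‖x - y‖ := by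
    intro x hx y hy
    have := (hH.lipDeriv_freq hl hε hM).norm_sub_le isOpen_phase convex_phase
      (x := (0, x)) (y := (0, y)) ⟨mem_univ _, hx⟩ ⟨mem_univ _, hy⟩
    simpa [Prod.norm_def] using this
  obtain ⟨⟨pp, hpp, hfut⟩, pm, hpm, hpast⟩ := hH.exists_asymptotic hl hε hM0 hΩ hgR hg
  refine ⟨pm, hpm, pp, hpp, freq h pp, freq h pm, g,
    ⟨hH.asymptoticData hσ hl hε hΥ hK hpp hpm, fun t => ⟨?_, hg t⟩, hfut, hpast⟩, hg0⟩
  exact mem_ball_zero_iff.2 ((hgR t).trans_lt (by norm_num))
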